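/- arXiv:1802.09223 — 2 statements merged into one kernel-verified Lean document; each statement's English description precedes it below -/
import Mathlib

section
/- Let 𝔤 be a finite-dimensional Lie algebra over k and set mod(𝔤) = max over n with 𝔤₍ₙ₎ ≠ ∅ of (dim 𝔤₍ₙ₎ − n), where 𝔤₍ₙ₎ = {x ∈ 𝔤 : rank(ad x) = n}. Then the commuting variety satisfies dim C₂(𝔤) = dim_k 𝔤 + mod(𝔤). -/
/-- The Zariski topology on a `k`-vector space `V`. -/
noncomputable def zariski (k V : Type*) [CommRing k] [AddCommGroup V] [Module k V] :
    TopologicalSpace V :=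
  TopologicalSpace.generateFrom
    {U | ∃ f ∈ Algebra.adjoin k {g : V → k | IsLinearMap k g}, U = {v | f v ≠ 0}}

/-- The commuting variety of a Lie algebra. -/
def commSet (L : Type*) [LieRing L] : Set (L × L) := {p | ⁅p.1, p.2⁆ = 0}

/-- The dimension of a subset of a topological space: the Krull dimension of the
subspace. -/
noncomputable def sdim {V : Type*} (t : TopologicalSpace V) (S : Set V) : WithBot ℕ∞ :=
  @topologicalKrullDim S (TopologicalSpace.induced Subtype.val t)

/-- The rank stratum `𝔤₍ₙ₎ = {x ∈ 𝔤 : rank (ad x) = n}`. -/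
def grk (k L : Type*) [CommRing k] [LieRing L] [LieAlgebra k L] (n : ℕ) : Set L :=
  {x : L | Module.finrank k (LinearMap.range (LieAlgebra.ad k L x)) = n}

/-- `C` is an irreducible component of `Z`: a maximal irreducible subset of `Z`. -/
def IsIrrCompIn {X : Type*} (t : TopologicalSpace X) (Z C : Set X) : Prop :=
  C ⊆ Z ∧ @IsIrreducible X t C ∧
    ∀ D : Set X, D ⊆ Z → @IsIrreducible X t D → C ⊆ D → C = D


section DimAlg

theorem dle_of_integral {R S : Type*} [CommRing R] [CommRing S] (f : R →+* S)
    (hf : f.IsIntegral) : ringKrullDim S ≤ ringKrullDim R := by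
  let := f.toAlgebra
  have : Algebra.IsIntegral R S := ⟨hf⟩
  refine Order.krullDim_le_of_strictMono (PrimeSpectrum.comap f) ?_
  intro a b hab
  exact Ideal.IsIntegral.comap_lt_comap (R := R) (I := a.asIdeal) (J := b.asIdeal) hab

theorem dge_of_integral {R S : Type*} [CommRing R] [CommRing S] (f : R →+* S)
    (hf : f.IsIntegral) (hi : Function.Injective f) : ringKrullDim R ≤ ringKrullDim S := by
  let := f.toAlgebra
  have : Algebra.IsIntegral R S := ⟨hf⟩
  refine iSup_le fun l => ?_
  obtain ⟨Q, hQ⟩ := hf.comap_surjective hi l.head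
  have : Q.asIdeal.LiesOver (RelSeries.head l).asIdeal := ⟨by rw [← hQ]; rfl⟩
  obtain ⟨L, hL, -⟩ := Ideal.exists_ltSeries_of_hasGoingUp (S := S) l Q.asIdeal
  rw [← hL]
  exact le_iSup (fun l : LTSeries (PrimeSpectrum S) => (l.length : WithBot ℕ∞)) L

theorem num_le_of_domain {k A : Type*} [Field k] [CommRing A] [IsDomain A] [Algebra k A]
    {s t : ℕ} (g : MvPolynomial (Fin s) k →ₐ[k] A) (hg : Function.Injective g)
    (hgi : g.toRingHom.IsIntegral)
    (h : MvPolynomial (Fin t) k →ₐ[k] A) (hh : Function.Injective h) : t ≤ s := by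
  have h1 := lift_trdeg_le_of_injective h hh
  let := g.toRingHom.toAlgebra
  have : Algebra.IsIntegral (MvPolynomial (Fin s) k) A := ⟨hgi⟩
  have : IsScalarTower k (MvPolynomial (Fin s) k) A := .of_algHom g
  have : FaithfulSMul (MvPolynomial (Fin s) k) A :=
    (faithfulSMul_iff_algebraMap_injective _ _).mpr hg
  have h2 := lift_trdeg_add_eq k (MvPolynomial (Fin s) k) A
  rw [trdeg_eq_zero (R := MvPolynomial (Fin s) k) (A := A)] at h2
  simp only [MvPolynomial.trdeg_of_isDomain] at h1 h2
  simp at h1 h2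
  rw [← h2] at h1
  simpa using h1

theorem dle_of_injective {k A B : Type*} [Field k] [CommRing A] [CommRing B] [Algebra k A]
    [Algebra k B] [Algebra.FiniteType k A] [Algebra.FiniteType k B] (f : A →ₐ[k] B)
    (hf : Function.Injective f) : ringKrullDim A ≤ ringKrullDim B := by
  cases subsingleton_or_nontrivial A
  · rw [ringKrullDim_eq_bot_of_subsingleton]; exact bot_le
  obtain ⟨t, h, hh, hhi⟩ := exists_integral_inj_algHom_of_fg k A
  have h1 := dle_of_integral _ hhi
  refine h1.trans ?_
  obtain ⟨p, hp, hpc⟩ := Ideal.exists_comap_eq_of_mem_minimalPrimes_of_injective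
    (f := (f.comp h).toRingHom) (hf.comp hh) ⊥
    (by rw [IsDomain.minimalPrimes_eq_singleton_bot]; rfl)
  have : Algebra.FiniteType k (B ⧸ p) := inferInstance
  obtain ⟨s, g, hg, hgi⟩ := exists_integral_inj_algHom_of_fg k (B ⧸ p)
  have h2 := dge_of_integral _ hgi hg
  have h3 : t ≤ s := by
    refine num_le_of_domain g hg hgi ((Ideal.Quotient.mkₐ k p).comp (f.comp h)) ?_
    rw [injective_iff_map_eq_zero]
    intro a ha
    have : a ∈ p.comap (f.comp h).toRingHom := by
      rw [Ideal.mem_comap]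
      exact Ideal.Quotient.eq_zero_iff_mem.mp ha
    rw [hpc] at this
    exact this
  refine le_trans ?_ (h2.trans (ringKrullDim_quotient_le p))
  simp only [MvPolynomial.ringKrullDim_of_isNoetherianRing]
  gcongr
  simpa using h3

theorem dim_ne_top {k A : Type*} [Field k] [CommRing A] [Algebra k A]
    [Algebra.FiniteType k A] [Nontrivial A] : ∃ d : ℕ, ringKrullDim A = d := by
  obtain ⟨t, h, hh, hhi⟩ := exists_integral_inj_algHom_of_fg k A
  refine ⟨t, ?_⟩
  rw [← le_antisymm (dge_of_integral _ hhi hh) (dle_of_integral _ hhi)]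
  simp

theorem len_le_of_ker {R S : Type*} [CommRing R] [CommRing S] (f : R →+* S)
    (hf : Function.Surjective f) (l : LTSeries (PrimeSpectrum R))
    (h : RingHom.ker f ≤ l.head.asIdeal) : (l.length : WithBot ℕ∞) ≤ ringKrullDim S := by
  rw [← ringKrullDim_eq_of_ringEquiv (RingHom.quotientKerEquivOfSurjective hf),
    ringKrullDim_quotient]
  let L : LTSeries (PrimeSpectrum.zeroLocus (R := R) (RingHom.ker f)) :=
    ⟨l.length, fun i => ⟨l i, h.trans (LTSeries.head_le l i)⟩, fun i => l.step i⟩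
  exact le_iSup (fun l : LTSeries (PrimeSpectrum.zeroLocus (R := R) (RingHom.ker f)) =>
    (l.length : WithBot ℕ∞)) L

theorem dle_of_prod {R S T : Type*} [CommRing R] [CommRing S] [CommRing T] (f : R →+* S)
    (g : R →+* T) (hf : Function.Surjective f) (hg : Function.Surjective g)
    (hfg : ∀ r, f r = 0 → g r = 0 → r = 0) :
    ringKrullDim R ≤ ringKrullDim S ⊔ ringKrullDim T := by
  refine iSup_le fun l => ?_
  have : RingHom.ker f * RingHom.ker g ≤ l.head.asIdeal := by
    rw [Ideal.mul_le]
    intro r hr s hs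
    rw [hfg (r * s) (by simp [(RingHom.mem_ker).1 hr]) (by simp [(RingHom.mem_ker).1 hs])]
    exact zero_mem _
  rcases (l.head.2.mul_le).1 this with h | h
  · exact (len_le_of_ker f hf l h).trans le_sup_left
  · exact (len_le_of_ker g hg l h).trans le_sup_right

end DimAlg

section Top

open Topology TopologicalSpace

theorem topdim_le_of_dense {X Y : Type*} [TopologicalSpace X] [TopologicalSpace Y] {f : X → Y}
    (hf : IsInducing f) (h : ∀ Z : Set Y, IsClosed Z → closure (f '' (f ⁻¹' Z)) = Z) :
    topologicalKrullDim Y ≤ topologicalKrullDim X := by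
  have irr : ∀ Z : IrreducibleCloseds Y, IsIrreducible (f ⁻¹' (Z : Set Y)) := by
    intro Z
    have hZ := h Z Z.isClosed
    constructor
    · rw [← Set.image_nonempty (f := f), ← closure_nonempty_iff, hZ]
      exact Z.isIrreducible.nonempty
    · intro U V hU hV hxU hyV
      obtain ⟨U', hU', rfl⟩ := hf.isOpen_iff.1 hU
      obtain ⟨V', hV', rfl⟩ := hf.isOpen_iff.1 hV
      obtain ⟨x, hx, hx'⟩ := hxU
      obtain ⟨y, hy, hy'⟩ := hyV
      obtain ⟨z, hz, hz'⟩ := Z.isIrreducible.2 U' V' hU' hV' ⟨f x, hx, hx'⟩ ⟨f y, hy, hy'⟩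
      rw [← hZ] at hz
      obtain ⟨w, hw, v, hv, rfl⟩ := mem_closure_iff.1 hz _ (hU'.inter hV') hz'
      exact ⟨v, hv, hw⟩
  refine Order.krullDim_le_of_strictMono
    (fun Z => (⟨f ⁻¹' (Z : Set Y), irr Z, Z.isClosed.preimage hf.continuous⟩ :
      IrreducibleCloseds X)) ?_
  refine Monotone.strictMono_of_injective (fun Z W hZW => Set.preimage_mono (f := f) (s := (Z : Set Y)) (t := W) hZW) ?_
  intro Z W hZW
  have : f ⁻¹' (Z : Set Y) = f ⁻¹' (W : Set Y) := congrArg (fun T : IrreducibleCloseds X => (T : Set X)) hZW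
  apply SetLike.coe_injective
  rw [← h Z Z.isClosed, this, h W W.isClosed]

variable {k X Y : Type*} [Field k]

/-- topology generated by an algebra of functions -/
def zt (A : Subalgebra k (X → k)) : TopologicalSpace X :=
  TopologicalSpace.generateFrom {U | ∃ f ∈ A, U = {v | f v ≠ 0}}

/-- evaluation -/
def evA (A : Subalgebra k (X → k)) (x : X) : A →ₐ[k] k :=
  (Pi.evalAlgHom k (fun _ : X => k) x).comp A.val

@[simp] theorem evA_apply (A : Subalgebra k (X → k)) (x : X) (f : A) : evA A x f = f.1 x := rfl

/-- point to prime -/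
def toSpec (A : Subalgebra k (X → k)) (x : X) : PrimeSpectrum A :=
  ⟨RingHom.ker (evA A x), RingHom.ker_isPrime _⟩

theorem toSpec_inducing (A : Subalgebra k (X → k)) :
    @IsInducing X (PrimeSpectrum A) (zt A) _ (toSpec A) := by
  let _ := zt A
  constructor
  rw [(PrimeSpectrum.isTopologicalBasis_basic_opens (R := A)).eq_generateFrom,
    induced_generateFrom_eq]
  change generateFrom _ = generateFrom _
  congr 1
  ext U
  constructor
  · rintro ⟨f, hf, rfl⟩
    exact ⟨_, ⟨⟨f, hf⟩, rfl⟩, rfl⟩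
  · rintro ⟨_, ⟨f, rfl⟩, rfl⟩
    exact ⟨f.1, f.2, rfl⟩

theorem zt_dim_le (A : Subalgebra k (X → k)) :
    @topologicalKrullDim X (zt A) ≤ ringKrullDim A := by
  let _ := zt A
  rw [← PrimeSpectrum.topologicalKrullDim_eq_ringKrullDim]
  exact (toSpec_inducing A).topologicalKrullDim_le

/-- affine: finite type and all homs are evaluations -/
def AffA (A : Subalgebra k (X → k)) : Prop :=
  Algebra.FiniteType k A ∧ ∀ φ : A →ₐ[k] k, ∃ x, ∀ f : A, φ f = f.1 x

theorem zt_dim_ge [IsAlgClosed k] (A : Subalgebra k (X → k)) (hA : AffA A) :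
    ringKrullDim A ≤ @topologicalKrullDim X (zt A) := by
  let _ := zt A
  have := hA.1
  rw [← PrimeSpectrum.topologicalKrullDim_eq_ringKrullDim]
  refine topdim_le_of_dense (toSpec_inducing A) fun Z hZ => ?_
  have : IsJacobsonRing A := isJacobsonRing_of_finiteType (A := k)
  have hsub : closedPoints (PrimeSpectrum A) ⊆ Set.range (toSpec A) := by
    intro m hm
    rw [mem_closedPoints_iff, PrimeSpectrum.isClosed_singleton_iff_isMaximal] at hm
    let _ := Ideal.Quotient.field m.asIdeal
    have : Module.Finite k (A ⧸ m.asIdeal) := finite_of_finite_type_of_isJacobsonRing _ _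
    have : Algebra.IsIntegral k (A ⧸ m.asIdeal) := Algebra.IsIntegral.of_finite _ _
    have hb := IsAlgClosed.algebraMap_bijective_of_isIntegral (k := k) (K := A ⧸ m.asIdeal)
    let e : k ≃ₐ[k] (A ⧸ m.asIdeal) := AlgEquiv.ofBijective (Algebra.ofId _ _) hb
    obtain ⟨x, hx⟩ := hA.2 (e.symm.toAlgHom.comp (Ideal.Quotient.mkₐ k m.asIdeal))
    refine ⟨x, ?_⟩
    ext f
    change f ∈ RingHom.ker (evA A x) ↔ _
    rw [RingHom.mem_ker, evA_apply, ← hx]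
    simp [Ideal.Quotient.eq_zero_iff_mem]
  refine subset_antisymm (closure_minimal (Set.image_preimage_subset _ _) hZ) ?_
  rw [Set.image_preimage_eq_inter_range]
  conv_lhs => rw [← closure_inter_closedPoints hZ]
  exact closure_mono (Set.inter_subset_inter_right _ hsub)

/-- pullback -/
def pullA (k : Type*) [Field k] (F : Y → X) : (X → k) →ₐ[k] (Y → k) :=
  AlgHom.pi (fun y => Pi.evalAlgHom k (fun _ : X => k) (F y))

@[simp] theorem pullA_apply (F : Y → X) (f : X → k) (y : Y) : pullA k F f y = f (F y) := rfl

/-- restriction of an algebra of functions to a subset -/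
def resA (A : Subalgebra k (X → k)) (S : Set X) : Subalgebra k (S → k) :=
  A.map (pullA k Subtype.val)

theorem resA_mem (A : Subalgebra k (X → k)) (S : Set X) {f : X → k} (hf : f ∈ A) :
    (fun s : S => f s) ∈ resA A S := ⟨f, hf, rfl⟩

theorem ft_map {A : Subalgebra k (X → k)} (hA : Algebra.FiniteType k A)
    (φ : (X → k) →ₐ[k] (Y → k)) : Algebra.FiniteType k (A.map φ) := by
  rw [← Subalgebra.fg_iff_finiteType] at hA ⊢
  exact hA.map φ

theorem resA_ft {A : Subalgebra k (X → k)} (hA : Algebra.FiniteType k A) (S : Set X) :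
    Algebra.FiniteType k (resA A S) := ft_map hA _

/-- algebraic dimension -/
noncomputable def dd (A : Subalgebra k (X → k)) (S : Set X) : WithBot ℕ∞ := ringKrullDim (resA A S)

theorem zt_induced (A : Subalgebra k (X → k)) (S : Set X) :
    TopologicalSpace.induced (Subtype.val : S → X) (zt A) = zt (resA A S) := by
  unfold zt
  rw [induced_generateFrom_eq]
  congr 1
  ext U
  constructor
  · rintro ⟨_, ⟨f, hf, rfl⟩, rfl⟩
    exact ⟨_, resA_mem A S hf, rfl⟩
  · rintro ⟨_, ⟨f, hf, rfl⟩, rfl⟩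
    exact ⟨_, ⟨f, hf, rfl⟩, rfl⟩

theorem sdim_eq_zt (A : Subalgebra k (X → k)) (S : Set X) :
    sdim (zt A) S = @topologicalKrullDim S (zt (resA A S)) := by
  unfold sdim
  rw [zt_induced]

theorem sdim_le_dd (A : Subalgebra k (X → k)) (S : Set X) : sdim (zt A) S ≤ dd A S := by
  rw [sdim_eq_zt]; exact zt_dim_le _

theorem sdim_mono (t : TopologicalSpace X) {S T : Set X} (h : S ⊆ T) : sdim t S ≤ sdim t T := by
  unfold sdim
  let _ := t
  exact (IsEmbedding.inclusion h).isInducing.topologicalKrullDim_le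

/-- restriction from a larger subset -/
def resHom (A : Subalgebra k (X → k)) {S T : Set X} (h : S ⊆ T) : resA A T →ₐ[k] resA A S :=
  AlgHom.codRestrict ((pullA k (Set.inclusion h)).comp (resA A T).val) (resA A S) (by
    rintro ⟨_, ⟨f, hf, rfl⟩⟩
    exact ⟨f, hf, rfl⟩)

theorem resHom_surj (A : Subalgebra k (X → k)) {S T : Set X} (h : S ⊆ T) :
    Function.Surjective (resHom A h) := by
  rintro ⟨_, ⟨f, hf, rfl⟩⟩
  exact ⟨⟨_, ⟨f, hf, rfl⟩⟩, rfl⟩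

theorem resHom_apply (A : Subalgebra k (X → k)) {S T : Set X} (h : S ⊆ T) (f : resA A T) (s : S) :
    (resHom A h f).1 s = f.1 (Set.inclusion h s) := rfl

theorem dd_mono (A : Subalgebra k (X → k)) {S T : Set X} (h : S ⊆ T) : dd A S ≤ dd A T :=
  ringKrullDim_le_of_surjective (resHom A h).toRingHom (resHom_surj A h)

theorem dd_union (A : Subalgebra k (X → k)) (S T : Set X) : dd A (S ∪ T) ≤ dd A S ⊔ dd A T := by
  refine dle_of_prod (resHom A Set.subset_union_left).toRingHom
    (resHom A Set.subset_union_right).toRingHom (resHom_surj A _) (resHom_surj A _) ?_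
  intro r hS hT
  ext ⟨x, hx⟩
  rcases hx with hx | hx
  · exact congrFun (congrArg Subtype.val hS) ⟨x, hx⟩
  · exact congrFun (congrArg Subtype.val hT) ⟨x, hx⟩

theorem dd_empty (A : Subalgebra k (X → k)) : dd A ∅ = ⊥ := by
  have : Subsingleton (resA A ∅) := ⟨fun a b => by ext ⟨x, hx⟩; exact hx.elim⟩
  exact ringKrullDim_eq_bot_of_subsingleton

theorem dd_biUnion_le (A : Subalgebra k (X → k)) {ι : Type*} (T : Finset ι) (S : ι → Set X)
    (c : WithBot ℕ∞) (h : ∀ t ∈ T, dd A (S t) ≤ c) : dd A (⋃ t ∈ T, S t) ≤ c := by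
  classical
  induction T using Finset.induction_on with
  | empty => simp [dd_empty]
  | insert a T ha ih =>
    rw [Finset.set_biUnion_insert]
    refine (dd_union A _ _).trans (sup_le (h a (by simp)) (ih fun t ht => h t (by simp [ht])))

theorem exists_finite_cover {A : Subalgebra k (X → k)} (hA : Algebra.FiniteType k A) (S : Set X)
    (δ : X → (X → k)) (hδ : ∀ x ∈ S, δ x ∈ A ∧ δ x x ≠ 0) :
    ∃ T : Finset X, (∀ t ∈ T, t ∈ S) ∧ ∀ x ∈ S, ∃ t ∈ T, δ t x ≠ 0 := by
  let _ := zt A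
  have : IsNoetherianRing A := Algebra.FiniteType.isNoetherianRing k A
  have : NoetherianSpace X := (toSpec_inducing A).noetherianSpace
  obtain ⟨T, hT, hST⟩ := (NoetherianSpace.isCompact S).elim_nhds_subcover
    (fun x => {v | δ x v ≠ 0}) (fun x hx => IsOpen.mem_nhds
      (isOpen_generateFrom_of_mem ⟨δ x, (hδ x hx).1, rfl⟩) (hδ x hx).2)
  refine ⟨T, hT, fun x hx => ?_⟩
  simpa using hST hx

theorem dim_le_of_surj {A : Subalgebra k (X → k)} {B : Subalgebra k (Y → k)}
    (hA : Algebra.FiniteType k A) (hB : Algebra.FiniteType k B) (F : X → Y)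
    (hF : Function.Surjective F) (h : ∀ b ∈ B, (fun x => b (F x)) ∈ A) :
    ringKrullDim B ≤ ringKrullDim A := by
  let φ : B →ₐ[k] A := AlgHom.codRestrict ((pullA k F).comp B.val) A (fun b => h b.1 b.2)
  refine dle_of_injective φ ?_
  intro b c hbc
  ext y
  obtain ⟨x, rfl⟩ := hF y
  exact congrFun (congrArg Subtype.val hbc) x

theorem sdim_eq_dd_of_prin [IsAlgClosed k] {A : Subalgebra k (X → k)} (hA : AffA A)
    (I : Set (X → k)) (hI : I ⊆ A) (f : X → k) (hf : f ∈ A) (S : Set X)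
    (hS : ∀ x, x ∈ S ↔ (∀ g ∈ I, g x = 0) ∧ f x ≠ 0) : sdim (zt A) S = dd A S := by
  refine le_antisymm (sdim_le_dd A S) ?_
  let B : Subalgebra k (S → k) := resA A S ⊔ Algebra.adjoin k {fun s : S => (f s)⁻¹}
  have hfS : ∀ s : S, f s ≠ 0 := fun s => ((hS s).1 s.2).2
  have hAB : resA A S ≤ B := le_sup_left
  have hB : Algebra.FiniteType k B := by
    have := resA_ft hA.1 S
    rw [← Subalgebra.fg_iff_finiteType] at this ⊢
    exact this.sup ⟨{fun s : S => (f s)⁻¹}, by simp⟩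
  have hfi : (fun s : S => (f s)⁻¹) ∈ B :=
    (le_sup_right : Algebra.adjoin k {fun s : S => (f s)⁻¹} ≤ B) (Algebra.subset_adjoin rfl)
  have key : ∀ b ∈ B, ∃ n : ℕ, (fun s : S => f s ^ n * b s) ∈ resA A S := by
    have hfA := resA_mem A S hf
    have : B = Algebra.adjoin k ((resA A S : Set (S → k)) ∪ {fun s : S => (f s)⁻¹}) := by
      rw [Algebra.adjoin_union, Algebra.adjoin_eq]
    rw [this]
    intro b hb
    induction hb using Algebra.adjoin_induction with
    | mem x hx =>
      rcases hx with hx | rfl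
      · exact ⟨0, by simpa using hx⟩
      · refine ⟨1, ?_⟩
        convert (resA A S).one_mem using 1
        ext s
        simp [hfS s]
    | algebraMap r =>
      exact ⟨0, by convert (resA A S).algebraMap_mem r using 1; ext s; simp⟩
    | add x y _ _ hx hy =>
      obtain ⟨n, hn⟩ := hx
      obtain ⟨m, hm⟩ := hy
      refine ⟨n + m, ?_⟩
      convert (resA A S).add_mem ((resA A S).mul_mem ((resA A S).pow_mem hfA m) hn)
        ((resA A S).mul_mem ((resA A S).pow_mem hfA n) hm) using 1
      ext s
      simp only [Pi.add_apply, Pi.mul_apply, Pi.pow_apply]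
      ring
    | mul x y _ _ hx hy =>
      obtain ⟨n, hn⟩ := hx
      obtain ⟨m, hm⟩ := hy
      refine ⟨n + m, ?_⟩
      convert (resA A S).mul_mem hn hm using 1
      ext s
      simp only [Pi.mul_apply]
      ring
  have htop : zt (resA A S) = zt B := by
    unfold zt
    congr 1
    ext U
    constructor
    · rintro ⟨g, hg, rfl⟩
      exact ⟨g, hAB hg, rfl⟩
    · rintro ⟨g, hg, rfl⟩
      obtain ⟨n, hn⟩ := key g hg
      refine ⟨_, hn, ?_⟩
      ext s
      simp [hfS s]
  have haff : AffA B := by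
    refine ⟨hB, fun φ => ?_⟩
    let ψ : A →ₐ[k] B := AlgHom.codRestrict ((pullA k Subtype.val).comp A.val) B
      (fun a => hAB (resA_mem A S a.2))
    obtain ⟨x, hx⟩ := hA.2 (φ.comp ψ)
    have hxS : x ∈ S := by
      rw [hS]
      constructor
      · intro g hg
        have h0 : ψ ⟨g, hI hg⟩ = 0 := by
          ext s
          exact ((hS s).1 s.2).1 g hg
        have := hx ⟨g, hI hg⟩
        rw [AlgHom.comp_apply, h0, map_zero] at this
        exact this.symm
      · intro h0
        have h1 : ψ ⟨f, hf⟩ * ⟨_, hfi⟩ = 1 := by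
          ext s
          exact mul_inv_cancel₀ (hfS s)
        have this : φ (ψ ⟨f, hf⟩) = f x := hx ⟨f, hf⟩
        have h2 := congrArg φ h1
        rw [map_mul, this, map_one, h0, zero_mul] at h2
        exact zero_ne_one h2
    refine ⟨⟨x, hxS⟩, ?_⟩
    intro b
    obtain ⟨n, a, ha, han⟩ := key b.1 b.2
    have h1 : ψ ⟨f, hf⟩ ^ n * b = ψ ⟨a, ha⟩ := by
      ext s
      exact (congrFun han s).symm
    have h2 := congrArg φ h1
    rw [map_mul, map_pow] at h2
    have e1 : φ (ψ ⟨f, hf⟩) = f x := hx ⟨f, hf⟩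
    have e2 : φ (ψ ⟨a, ha⟩) = a x := hx ⟨a, ha⟩
    rw [e1, e2] at h2
    have h3 : a x = f x ^ n * b.1 ⟨x, hxS⟩ := congrFun han ⟨x, hxS⟩
    rw [h3] at h2
    exact mul_left_cancel₀ (pow_ne_zero n (hfS ⟨x, hxS⟩)) h2
  rw [sdim_eq_zt, htop]
  refine le_trans ?_ (zt_dim_ge B haff)
  exact dim_le_of_surj hB (resA_ft hA.1 S) id Function.surjective_id (fun b hb => hAB hb)

end Top

section Poly

open MvPolynomial

variable {k X Y V W U : Type*} [Field k]
variable [AddCommGroup V] [Module k V] [AddCommGroup W] [Module k W] [AddCommGroup U] [Module k U]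

/-- polynomial functions -/
def PA (k V : Type*) [Field k] [AddCommGroup V] [Module k V] : Subalgebra k (V → k) :=
  Algebra.adjoin k {g : V → k | IsLinearMap k g}

theorem lin_mem (f : V →ₗ[k] k) : (fun v => f v) ∈ PA k V :=
  Algebra.subset_adjoin f.isLinear

/-- regular maps into a vector space -/
def Reg (C : Subalgebra k (Y → k)) (g : Y → V) : Prop := ∀ l : V →ₗ[k] k, (fun y => l (g y)) ∈ C

theorem Reg.lin {C : Subalgebra k (Y → k)} {g : Y → V} (h : Reg C g) (f : V →ₗ[k] W) :
    Reg C (fun y => f (g y)) := fun l => h (l.comp f)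

theorem Reg.add {C : Subalgebra k (Y → k)} {g g' : Y → V} (h : Reg C g) (h' : Reg C g') :
    Reg C (fun y => g y + g' y) := fun l => by
  have := C.add_mem (h l) (h' l)
  convert this using 1
  ext y
  simp

theorem Reg.smul {C : Subalgebra k (Y → k)} {f : Y → k} {g : Y → V} (hf : f ∈ C) (h : Reg C g) :
    Reg C (fun y => f y • g y) := fun l => by
  have := C.mul_mem hf (h l)
  convert this using 1
  ext y
  simp

theorem Reg.sub {C : Subalgebra k (Y → k)} {g g' : Y → V} (h : Reg C g) (h' : Reg C g') :
    Reg C (fun y => g y - g' y) := fun l => by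
  have := C.sub_mem (h l) (h' l)
  convert this using 1
  ext y
  simp

theorem Reg.sum {C : Subalgebra k (Y → k)} {ι : Type*} (s : Finset ι) {g : ι → Y → V}
    (h : ∀ i ∈ s, Reg C (g i)) : Reg C (fun y => ∑ i ∈ s, g i y) := fun l => by
  have := C.sum_mem (fun i hi => h i hi l)
  convert this using 1
  ext y
  simp

theorem Reg.pi {C : Subalgebra k (Y → k)} {n : ℕ} {g : Y → (Fin n → k)}
    (h : ∀ i, (fun y => g y i) ∈ C) : Reg C g := fun l => by
  have : (fun y => l (g y)) = fun y => ∑ i, l (Pi.single i 1) * g y i := by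
    ext y
    conv_lhs => rw [← Finset.univ_sum_single (g y)]
    rw [map_sum]
    refine Finset.sum_congr rfl fun i _ => ?_
    have : (Pi.single i (g y i) : Fin n → k) = g y i • Pi.single i 1 := by
      rw [← Pi.single_smul]; simp
    rw [this, map_smul, smul_eq_mul, mul_comm]
  rw [this]
  have := C.sum_mem (t := Finset.univ) (fun i _ => C.smul_mem (h i) (l (Pi.single i 1)))
  convert this using 1
  ext y
  simp

theorem Reg.coord {C : Subalgebra k (Y → k)} {n : ℕ} {g : Y → (Fin n → k)}
    (h : Reg C g) (i : Fin n) : (fun y => g y i) ∈ C := h (LinearMap.proj i)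

theorem Reg.bilin [Module.Finite k W] {C : Subalgebra k (Y → k)} {g : Y → V} {h : Y → W}
    (hg : Reg C g) (hh : Reg C h) (B : V →ₗ[k] W →ₗ[k] U) : Reg C (fun y => B (g y) (h y)) := by
  let b := Module.finBasis k W
  have : (fun y => B (g y) (h y)) = fun y => ∑ i, b.coord i (h y) • B.flip (b i) (g y) := by
    ext y
    conv_lhs => rw [← b.sum_repr (h y), map_sum]
    refine Finset.sum_congr rfl fun i _ => ?_
    rw [map_smul]
    rfl
  rw [this]
  exact Reg.sum _ fun i _ => Reg.smul (hh _) (hg.lin _)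

theorem det_mem {C : Subalgebra k (Y → k)} {n : ℕ} {M : Y → Matrix (Fin n) (Fin n) k}
    (h : ∀ i j, (fun y => M y i j) ∈ C) : (fun y => (M y).det) ∈ C := by
  have : (fun y => (M y).det) =
      ∑ σ : Equiv.Perm (Fin n), ((Equiv.Perm.sign σ : ℤ) : k) • ∏ i, fun y => M y (σ i) i := by
    ext y
    rw [Matrix.det_apply]
    simp [Finset.sum_apply, Units.smul_def]
  rw [this]
  exact C.sum_mem fun σ _ => C.smul_mem (C.prod_mem fun i _ => h _ _) _

theorem adj_mem {C : Subalgebra k (Y → k)} {n : ℕ} {M : Y → Matrix (Fin n) (Fin n) k}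
    (h : ∀ i j, (fun y => M y i j) ∈ C) (i j : Fin n) : (fun y => (M y).adjugate i j) ∈ C := by
  simp only [Matrix.adjugate_apply]
  refine det_mem fun a b => ?_
  by_cases hab : a = j
  · subst hab
    simp only [Matrix.updateRow_self]
    exact C.algebraMap_mem _
  · simp only [Matrix.updateRow_ne hab]
    exact h a b

theorem PA_pull {C : Subalgebra k (Y → k)} {g : Y → V} (h : Reg C g) :
    ∀ b ∈ PA k V, (fun y => b (g y)) ∈ C := by
  have : PA k V ≤ C.comap (pullA k g) := by
    refine Algebra.adjoin_le ?_
    intro f hf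
    exact h (IsLinearMap.mk' f hf)
  exact fun b hb => this hb

theorem PA_eq {ι : Type*} [Finite ι] (b : Module.Basis ι k V) :
    PA k V = Algebra.adjoin k (Set.range fun i => (fun v => b.coord i v)) := by
  have := Fintype.ofFinite ι
  apply le_antisymm
  · refine Algebra.adjoin_le ?_
    intro f hf
    have : f = ∑ i, f (b i) • (fun v => b.coord i v) := by
      ext v
      have : f v = IsLinearMap.mk' f hf v := rfl
      rw [this]
      conv_lhs => rw [← b.sum_repr v, map_sum]
      rw [Finset.sum_apply]
      refine Finset.sum_congr rfl fun i _ => ?_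
      rw [map_smul]
      simp [mul_comm]
    rw [this]
    exact Subalgebra.sum_mem _ fun i _ => Subalgebra.smul_mem _ (Algebra.subset_adjoin (Set.mem_range_self i)) _
  · refine Algebra.adjoin_le ?_
    rintro _ ⟨i, rfl⟩
    exact lin_mem _

theorem PA_aff [Module.Finite k V] : AffA (PA k V) := by
  let b := Module.finBasis k V
  constructor
  · rw [← Subalgebra.fg_iff_finiteType, PA_eq b]
    exact Subalgebra.fg_def.2 ⟨_, Set.finite_range _, rfl⟩
  · intro φ
    let v := ∑ i, φ ⟨_, lin_mem (b.coord i)⟩ • b i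
    refine ⟨v, ?_⟩
    have : PA k V ≤ Subalgebra.map (PA k V).val (AlgHom.equalizer φ (evA (PA k V) v)) := by
      conv_lhs => rw [PA_eq b]
      refine Algebra.adjoin_le ?_
      rintro _ ⟨i, rfl⟩
      refine ⟨⟨_, lin_mem (b.coord i)⟩, ?_, rfl⟩
      change φ _ = b.coord i v
      simp [v, Finsupp.single_apply]
    intro f
    obtain ⟨g, hg, hgf⟩ := this f.2
    have : g = f := Subtype.ext hgf
    subst this
    exact hg

/-- evaluation of polynomials over a function algebra -/
noncomputable def prodHom (A : Subalgebra k (X → k)) (r : ℕ) :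
    MvPolynomial (Fin r) A →ₐ[k] (X × (Fin r → k) → k) :=
  AlgHom.pi (fun p => (MvPolynomial.aeval p.2 : MvPolynomial (Fin r) k →ₐ[k] k).comp
    (MvPolynomial.mapAlgHom (evA A p.1)))

theorem prodHom_inj [Infinite k] (A : Subalgebra k (X → k)) (r : ℕ) :
    Function.Injective (prodHom A r) := by
  rw [injective_iff_map_eq_zero]
  intro f hf
  ext m x
  have : MvPolynomial.map (evA A x).toRingHom f = 0 := by
    refine MvPolynomial.funext fun z => ?_
    have := congrFun hf (x, z)
    simpa [prodHom] using this
  have := congrArg (MvPolynomial.coeff m) this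
  rw [MvPolynomial.coeff_map] at this
  simpa using this

/-- product algebra -/
noncomputable def prodA (A : Subalgebra k (X → k)) (r : ℕ) : Subalgebra k (X × (Fin r → k) → k) :=
  (prodHom A r).range

theorem prodA_ft {A : Subalgebra k (X → k)} (hA : Algebra.FiniteType k A) (r : ℕ) :
    Algebra.FiniteType k (prodA A r) := by
  have : Algebra.FiniteType k (MvPolynomial (Fin r) A) := Algebra.FiniteType.trans hA inferInstance
  exact Algebra.FiniteType.of_surjective (prodHom A r).rangeRestrict
    (prodHom A r).rangeRestrict_surjective

theorem prodA_dim [Infinite k] {A : Subalgebra k (X → k)} (hA : Algebra.FiniteType k A) (r : ℕ) :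
    ringKrullDim (prodA A r) = ringKrullDim A + r := by
  have : IsNoetherianRing A := Algebra.FiniteType.isNoetherianRing k A
  unfold prodA
  rw [← ringKrullDim_eq_of_ringEquiv (AlgEquiv.ofInjective _ (prodHom_inj A r)).toRingEquiv,
    MvPolynomial.ringKrullDim_of_isNoetherianRing]
  simp

theorem prodA_fst (A : Subalgebra k (X → k)) (r : ℕ) {f : X → k} (hf : f ∈ A) :
    (fun p : X × (Fin r → k) => f p.1) ∈ prodA A r :=
  ⟨MvPolynomial.C ⟨f, hf⟩, by ext p; simp [prodHom]⟩

theorem prodA_snd (A : Subalgebra k (X → k)) (r : ℕ) (i : Fin r) :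
    (fun p : X × (Fin r → k) => p.2 i) ∈ prodA A r :=
  ⟨MvPolynomial.X i, by ext p; simp [prodHom]⟩

theorem prodA_pull {A : Subalgebra k (X → k)} {r : ℕ} {C : Subalgebra k (Y → k)}
    (G : Y → X × (Fin r → k)) (h1 : ∀ f ∈ A, (fun y => f (G y).1) ∈ C)
    (h2 : ∀ i, (fun y => (G y).2 i) ∈ C) : ∀ b ∈ prodA A r, (fun y => b (G y)) ∈ C := by
  rintro _ ⟨f, rfl⟩
  change pullA k G (prodHom A r f) ∈ C
  induction f using MvPolynomial.induction_on with
  | C a =>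
    convert h1 a.1 a.2 using 1
    ext y
    simp [prodHom]
  | add p q hp hq =>
    rw [map_add, map_add]
    exact C.add_mem hp hq
  | mul_X p i hp =>
    rw [map_mul, map_mul]
    refine C.mul_mem hp ?_
    convert h2 i using 1
    ext y
    simp [prodHom]

end Poly

section Triv

variable {k L : Type*} [Field k] [AddCommGroup L] [Module k L] [Module.Finite k L]

theorem triv_data (f : L →ₗ[k] L) (n : ℕ) (hn : Module.finrank k (LinearMap.range f) = n) :
    ∃ (r : ℕ) (i : (Fin n → k) →ₗ[k] L) (p : L →ₗ[k] (Fin n → k)) (q : L →ₗ[k] (Fin r → k))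
      (j : (Fin r → k) →ₗ[k] L), n + r = Module.finrank k L ∧ (∀ w, p (f (i w)) = w) ∧
      (∀ z, q (j z) = z) ∧ (∀ y, q y = 0 ↔ ∃ w, i w = y) := by
  let e : (Fin n → k) ≃ₗ[k] LinearMap.range f :=
    LinearEquiv.ofFinrankEq _ _ (by simp [hn])
  obtain ⟨s, hs⟩ := LinearMap.exists_rightInverse_of_surjective f.rangeRestrict
    (LinearMap.range_rangeRestrict f)
  let i : (Fin n → k) →ₗ[k] L := s ∘ₗ e.toLinearMap
  have hfi : ∀ w, f (i w) = (e w : L) := fun w =>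
    congrArg Subtype.val (LinearMap.congr_fun hs (e w))
  have hker : LinearMap.ker (f ∘ₗ i) = ⊥ := by
    rw [LinearMap.ker_eq_bot']
    intro w hw
    have : (e w : L) = 0 := by rw [← hfi]; exact hw
    simpa using this
  obtain ⟨p, hp⟩ := LinearMap.exists_leftInverse_of_injective _ hker
  have hpi : ∀ w, p (f (i w)) = w := fun w => LinearMap.congr_fun hp w
  have hinj : Function.Injective i := fun a b hab => by rw [← hpi a, hab, hpi]
  let Q := L ⧸ LinearMap.range i
  have hQ : Module.finrank k Q + n = Module.finrank k L := by
    rw [← Submodule.finrank_quotient_add_finrank (LinearMap.range i),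
      LinearMap.finrank_range_of_inj hinj]
    simp [Q]
  let e' : Q ≃ₗ[k] (Fin (Module.finrank k Q) → k) := LinearEquiv.ofFinrankEq _ _ (by simp)
  let q := e'.toLinearMap ∘ₗ (LinearMap.range i).mkQ
  have hq : Function.Surjective q := e'.surjective.comp (Submodule.mkQ_surjective _)
  obtain ⟨j, hj⟩ := LinearMap.exists_rightInverse_of_surjective q (LinearMap.range_eq_top.2 hq)
  refine ⟨_, i, p, q, j, by omega, hpi, fun z => LinearMap.congr_fun hj z, fun y => ?_⟩
  have : q y = 0 ↔ (LinearMap.range i).mkQ y = 0 :=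
    e'.map_eq_zero_iff
  rw [this, Submodule.mkQ_apply, Submodule.Quotient.mk_eq_zero]
  exact LinearMap.mem_range

theorem triv_dim [IsAlgClosed k] (T : L →ₗ[k] L →ₗ[k] L) (x0 : L) (n : ℕ)
    (hn : Module.finrank k (LinearMap.range (T x0)) = n) :
    ∃ δ ∈ PA k L, δ x0 ≠ 0 ∧ (∀ x, δ x ≠ 0 → n ≤ Module.finrank k (LinearMap.range (T x))) ∧
      dd (PA k (L × L)) {p : L × L | (Module.finrank k (LinearMap.range (T p.1)) = n ∧ δ p.1 ≠ 0) ∧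
        T p.1 p.2 = 0} =
      dd (PA k L) {x : L | Module.finrank k (LinearMap.range (T x)) = n ∧ δ x ≠ 0} +
        ((Module.finrank k L - n : ℕ) : WithBot ℕ∞) := by
  obtain ⟨r, i, p, q, j, hr, hpi, hqj, hqi⟩ := triv_data (T x0) n hn
  let M : L → Matrix (Fin n) (Fin n) k := fun x => LinearMap.toMatrix' (p ∘ₗ T x ∘ₗ i)
  have hM : ∀ x w, (M x).mulVec w = p (T x (i w)) := fun x w => by
    simp [M, LinearMap.toMatrix'_mulVec]
  let δ : L → k := fun x => (M x).det
  have hMmem : ∀ a b, (fun x => M x a b) ∈ PA k L := by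
    intro a b
    have : (fun x => M x a b) =
        fun x => (LinearMap.proj a ∘ₗ p ∘ₗ T.flip (i (Pi.single b 1))) x := by
      ext x
      simp [M, LinearMap.toMatrix'_apply]
    rw [this]
    exact lin_mem _
  have hδ : δ ∈ PA k L := det_mem hMmem
  have hsurj : ∀ x, δ x ≠ 0 → ∀ w, ∃ u, p (T x (i u)) = w := fun x hx w => by
    refine ⟨((δ x)⁻¹ • (M x).adjugate.mulVec w), ?_⟩
    rw [← hM, Matrix.mulVec_smul, Matrix.mulVec_mulVec, Matrix.mul_adjugate, Matrix.smul_mulVec,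
      Matrix.one_mulVec, smul_smul, inv_mul_cancel₀ hx, one_smul]
  have hiinj : ∀ x, δ x ≠ 0 → ∀ w, T x (i w) = 0 → w = 0 := fun x hx w hw => by
    have h1 : (M x).mulVec w = 0 := by rw [hM, hw, map_zero]
    have h2 := congrArg (M x).adjugate.mulVec h1
    rw [Matrix.mulVec_mulVec, Matrix.adjugate_mul, Matrix.smul_mulVec, Matrix.one_mulVec,
      Matrix.mulVec_zero] at h2
    exact (smul_eq_zero.1 h2).resolve_left hx
  have hrank : ∀ x, δ x ≠ 0 → n ≤ Module.finrank k (LinearMap.range (T x)) := fun x hx => by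
    have : Function.Injective (T x ∘ₗ i) := by
      rw [← LinearMap.ker_eq_bot, LinearMap.ker_eq_bot']
      exact hiinj x hx
    have h1 := LinearMap.finrank_range_of_inj this
    have h2 := Submodule.finrank_mono (LinearMap.range_comp_le_range i (T x))
    rw [h1] at h2
    simpa using h2
  have hpinj : ∀ x, Module.finrank k (LinearMap.range (T x)) = n → δ x ≠ 0 →
      ∀ y, p (T x y) = 0 → T x y = 0 := fun x hx hx' y hy => by
    have hs : Function.Surjective (p.domRestrict (LinearMap.range (T x))) := fun w => by
      obtain ⟨u, hu⟩ := hsurj x hx' w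
      exact ⟨⟨_, ⟨i u, rfl⟩⟩, hu⟩
    have hi := (LinearMap.injective_iff_surjective_of_finrank_eq_finrank
      (f := p.domRestrict (LinearMap.range (T x))) (by simp [hx])).2 hs
    have : (⟨T x y, ⟨y, rfl⟩⟩ : LinearMap.range (T x)) = 0 := hi (by rw [map_zero]; exact hy)
    exact congrArg Subtype.val this
  refine ⟨δ, hδ, ?_, hrank, ?_⟩
  · have : M x0 = 1 := by
      have : p ∘ₗ T x0 ∘ₗ i = LinearMap.id := LinearMap.ext hpi
      simp only [M, this, LinearMap.toMatrix'_id]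
    simp [δ, this]
  set S : Set L := {x : L | Module.finrank k (LinearMap.range (T x)) = n ∧ δ x ≠ 0} with hS
  set E : Set (L × L) := {p : L × L | (Module.finrank k (LinearMap.range (T p.1)) = n ∧ δ p.1 ≠ 0) ∧
        T p.1 p.2 = 0} with hE
  let φ : L → (Fin r → k) → L := fun x z =>
    δ x • j z - i ((M x).adjugate.mulVec (p (T x (j z))))
  have hφ1 : ∀ x ∈ S, ∀ z, T x (φ x z) = 0 := fun x hx z => by
    refine hpinj x hx.1 hx.2 _ ?_
    simp only [φ]
    rw [map_sub, map_sub, ← hM, Matrix.mulVec_mulVec, Matrix.mul_adjugate, Matrix.smul_mulVec,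
      Matrix.one_mulVec, map_smul, map_smul, sub_self]
  have hφ2 : ∀ x z, q (φ x z) = δ x • z := fun x z => by
    simp only [φ]
    rw [map_sub, map_smul, hqj, (hqi _).2 ⟨_, rfl⟩, sub_zero]
  have hφ3 : ∀ x ∈ S, ∀ y, T x y = 0 → φ x ((δ x)⁻¹ • q y) = y := fun x hx y hy => by
    have h1 : q (φ x ((δ x)⁻¹ • q y) - y) = 0 := by
      rw [map_sub, hφ2, smul_smul, mul_inv_cancel₀ hx.2, one_smul, sub_self]
    obtain ⟨w, hw⟩ := (hqi _).1 h1
    have h2 : T x (i w) = 0 := by rw [hw, map_sub, hφ1 x hx, hy, sub_self]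
    rw [hiinj x hx.2 w h2, map_zero] at hw
    exact (sub_eq_zero.1 hw.symm)
  have hNr : Module.finrank k L - n = r := by omega
  have hSft := resA_ft (PA_aff (k := k) (V := L)).1 S
  have hEft := resA_ft (PA_aff (k := k) (V := L × L)).1 E
  have hinf : Infinite k := inferInstance
  rw [hNr]
  unfold dd
  rw [← prodA_dim hSft r]
  apply le_antisymm
  · let F : S × (Fin r → k) → E := fun u => ⟨(u.1, φ u.1 u.2), u.1.2, hφ1 _ u.1.2 _⟩
    refine dim_le_of_surj (prodA_ft hSft r) hEft F ?_ ?_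
    · rintro ⟨⟨x, y⟩, hx, hy⟩
      refine ⟨(⟨x, hx⟩, (δ x)⁻¹ • q y), ?_⟩
      exact Subtype.ext (Prod.ext rfl (hφ3 x hx y hy))
    · rintro _ ⟨b, hb, rfl⟩
      let C := prodA (resA (PA k L) S) r
      have c1 : Reg C (fun u : S × (Fin r → k) => (u.1 : L)) := fun l =>
        prodA_fst _ r (resA_mem _ S (lin_mem l))
      have c2 : Reg C (fun u : S × (Fin r → k) => u.2) := Reg.pi fun a => prodA_snd _ r a
      have c3 : Reg C (fun u : S × (Fin r → k) => p (T u.1 (j u.2))) :=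
        (Reg.bilin c1 (c2.lin j) T).lin p
      have c4 : Reg C (fun u : S × (Fin r → k) =>
          (M u.1).adjugate.mulVec (p (T u.1 (j u.2)))) := by
        refine Reg.pi fun a => ?_
        have := C.sum_mem (t := Finset.univ) (fun b _ => C.mul_mem
          (PA_pull c1 _ (adj_mem hMmem a b)) (c3.coord b))
        convert this using 1
        ext u
        simp [Matrix.mulVec, dotProduct]
      have c5 : Reg C (fun u : S × (Fin r → k) => φ u.1 u.2) :=
        (Reg.smul (PA_pull c1 _ hδ) (c2.lin j)).sub (c4.lin i)
      have c6 : Reg C (fun u : S × (Fin r → k) => ((u.1 : L), φ u.1 u.2)) := by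
        have := (c1.lin (LinearMap.inl k L L)).add (c5.lin (LinearMap.inr k L L))
        convert this using 1
        ext u <;> simp
      exact PA_pull c6 b hb
  · let F : E → S × (Fin r → k) := fun u => (⟨u.1.1, u.2.1⟩, q u.1.2)
    refine dim_le_of_surj hEft (prodA_ft hSft r) F ?_ ?_
    · rintro ⟨⟨x, hx⟩, z⟩
      refine ⟨⟨(x, φ x ((δ x)⁻¹ • z)), hx, hφ1 x hx _⟩, ?_⟩
      refine Prod.ext rfl ?_
      change q (φ x ((δ x)⁻¹ • z)) = z
      rw [hφ2, smul_smul, mul_inv_cancel₀ hx.2, one_smul]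
    · let C := resA (PA k (L × L)) E
      have c0 : Reg C (fun u : E => (u : L × L)) := fun l => resA_mem _ E (lin_mem l)
      refine prodA_pull F ?_ ?_
      · rintro _ ⟨f, hf, rfl⟩
        exact PA_pull (c0.lin (LinearMap.fst k L L)) f hf
      · exact fun a => ((c0.lin (LinearMap.snd k L L)).lin q).coord a

end Triv

section Main

theorem dd_nat {k X : Type*} [Field k] {A : Subalgebra k (X → k)} (hA : Algebra.FiniteType k A)
    {S : Set X} (hS : S.Nonempty) : ∃ d : ℕ, dd A S = d := by
  have := resA_ft hA S
  obtain ⟨x, hx⟩ := hS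
  have : Nontrivial (resA A S) := ⟨0, 1, fun h => by
    have := congrFun (congrArg Subtype.val h) ⟨x, hx⟩
    exact zero_ne_one this⟩
  exact dim_ne_top (k := k)

variable {k L : Type*} [Field k] [IsAlgClosed k] [AddCommGroup L] [Module k L] [Module.Finite k L]

theorem stratum (T : L →ₗ[k] L →ₗ[k] L) (n : ℕ) :
    sdim (zt (PA k L)) {x | Module.finrank k (LinearMap.range (T x)) = n} =
      dd (PA k L) {x | Module.finrank k (LinearMap.range (T x)) = n} ∧
    dd (PA k (L × L)) {p : L × L | Module.finrank k (LinearMap.range (T p.1)) = n ∧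
      T p.1 p.2 = 0} =
      dd (PA k L) {x | Module.finrank k (LinearMap.range (T x)) = n} +
        ((Module.finrank k L - n : ℕ) : WithBot ℕ∞) := by
  choose δ hδ hδ0 hδr hδd using fun x0 : L => triv_dim T x0 _ rfl
  set R : L → ℕ := fun x => Module.finrank k (LinearMap.range (T x)) with hR
  set G : Set L := {x | R x = n} with hG
  set E : Set (L × L) := {p : L × L | R p.1 = n ∧ T p.1 p.2 = 0} with hE
  let S : L → Set L := fun t => {x | R x = n ∧ δ t x ≠ 0}
  let Et : L → Set (L × L) := fun t => {p | (R p.1 = n ∧ δ t p.1 ≠ 0) ∧ T p.1 p.2 = 0}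
  have hd : ∀ t ∈ G, dd (PA k (L × L)) (Et t) =
      dd (PA k L) (S t) + ((Module.finrank k L - n : ℕ) : WithBot ℕ∞) := by
    intro t ht
    have h := hδd t
    have ht' : R t = n := ht
    change dd (PA k (L × L)) {p | (R p.1 = R t ∧ δ t p.1 ≠ 0) ∧ T p.1 p.2 = 0} =
      dd (PA k L) {x | R x = R t ∧ δ t x ≠ 0} +
        ((Module.finrank k L - R t : ℕ) : WithBot ℕ∞) at h
    rw [ht'] at h
    exact h
  obtain ⟨F, hF, hcov⟩ := exists_finite_cover (PA_aff (k := k) (V := L)).1 G δ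
    (fun x _ => ⟨hδ x, hδ0 x⟩)
  have hGc : G ⊆ ⋃ t ∈ F, S t := fun x hx => by
    obtain ⟨t, ht, htx⟩ := hcov x hx
    exact Set.mem_biUnion ht ⟨hx, htx⟩
  have hEc : E ⊆ ⋃ t ∈ F, Et t := fun x hx => by
    obtain ⟨t, ht, htx⟩ := hcov x.1 hx.1
    exact Set.mem_biUnion ht ⟨⟨hx.1, htx⟩, hx.2⟩
  have hSG : ∀ t, S t ⊆ G := fun t x hx => hx.1
  have hEE : ∀ t, Et t ⊆ E := fun t x hx => ⟨hx.1.1, hx.2⟩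
  have hprin : ∀ t ∈ G, sdim (zt (PA k L)) (S t) = dd (PA k L) (S t) := by
    intro t ht
    have ht' : R t = n := ht
    refine sdim_eq_dd_of_prin PA_aff {g | g ∈ PA k L ∧ ∀ x, R x ≤ n → g x = 0}
      (fun g hg => hg.1) (δ t) (hδ t) (S t) fun x => ⟨?_, ?_⟩
    · rintro ⟨h1, h2⟩
      exact ⟨fun g hg => hg.2 x h1.le, h2⟩
    · rintro ⟨h1, h2⟩
      refine ⟨?_, h2⟩
      have h3 : n ≤ R x := ht' ▸ hδr t x h2
      by_contra hne
      refine hδ0 x (h1 (δ x) ⟨hδ x, fun y hy => ?_⟩)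
      by_contra hy'
      have : R x ≤ R y := hδr x y hy'
      omega
  constructor
  · refine le_antisymm (sdim_le_dd _ _) ?_
    refine (dd_mono _ hGc).trans (dd_biUnion_le _ F S _ fun t ht => ?_)
    rw [← hprin t (hF t ht)]
    exact sdim_mono _ (hSG t)
  · apply le_antisymm
    · refine (dd_mono _ hEc).trans (dd_biUnion_le _ F Et _ fun t ht => ?_)
      rw [hd t (hF t ht)]
      exact add_le_add_left (dd_mono _ (hSG t)) _
    · rcases F.eq_empty_or_nonempty with rfl | hne
      · have : G = ∅ := by
          refine Set.subset_eq_empty hGc ?_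
          simp
        rw [this, dd_empty, WithBot.bot_add]
        exact bot_le
      · obtain ⟨t, ht, hmax⟩ := Finset.exists_max_image F (fun t => dd (PA k L) (S t)) hne
        have h1 : dd (PA k L) G ≤ dd (PA k L) (S t) :=
          (dd_mono _ hGc).trans (dd_biUnion_le _ F S _ hmax)
        refine (add_le_add_left h1 _).trans ?_
        rw [← hd t (hF t ht)]
        exact dd_mono _ (hEE t)

theorem comm_sdim (T : L →ₗ[k] L →ₗ[k] L) :
    sdim (zt (PA k (L × L))) {p | T p.1 p.2 = 0} = dd (PA k (L × L)) {p | T p.1 p.2 = 0} := by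
  have h0 : Reg (PA k (L × L)) (fun p : L × L => p) := fun l => lin_mem l
  have h1 : Reg (PA k (L × L)) (fun p : L × L => T p.1 p.2) :=
    Reg.bilin (h0.lin (LinearMap.fst k L L)) (h0.lin (LinearMap.snd k L L)) T
  refine sdim_eq_dd_of_prin PA_aff (Set.range fun (l : L →ₗ[k] k) (p : L × L) => l (T p.1 p.2))
    ?_ 1 (Subalgebra.one_mem _) _ fun p => ?_
  · rintro _ ⟨l, rfl⟩
    exact h1 l
  · simp only [Set.mem_setOf_eq, Set.forall_mem_range, Pi.one_apply, ne_eq, one_ne_zero,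
      not_false_eq_true, and_true]
    exact (Module.forall_dual_apply_eq_zero_iff k _).symm

theorem main_abs (T : L →ₗ[k] L →ₗ[k] L) :
    ∃ m : ℕ,
      (∀ n : ℕ, {x | Module.finrank k (LinearMap.range (T x)) = n}.Nonempty →
        sdim (zt (PA k L)) {x | Module.finrank k (LinearMap.range (T x)) = n} ≤
          ((m + n : ℕ) : WithBot ℕ∞)) ∧
      (∃ n : ℕ, {x | Module.finrank k (LinearMap.range (T x)) = n}.Nonempty ∧
        sdim (zt (PA k L)) {x | Module.finrank k (LinearMap.range (T x)) = n} =
          ((m + n : ℕ) : WithBot ℕ∞)) ∧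
      sdim (zt (PA k (L × L))) {p | T p.1 p.2 = 0} =
        ((Module.finrank k L + m : ℕ) : WithBot ℕ∞) := by
  set R : L → ℕ := fun x => Module.finrank k (LinearMap.range (T x)) with hR
  set N := Module.finrank k L with hN
  have hRN : ∀ x, R x ≤ N := fun x => Submodule.finrank_le _
  set Z : Set (L × L) := {p | T p.1 p.2 = 0} with hZ
  let E : ℕ → Set (L × L) := fun n => {p | R p.1 = n ∧ T p.1 p.2 = 0}
  have hst : ∀ n, sdim (zt (PA k L)) {x | R x = n} = dd (PA k L) {x | R x = n} ∧
      dd (PA k (L × L)) (E n) = dd (PA k L) {x | R x = n} + ((N - n : ℕ) : WithBot ℕ∞) :=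
    fun n => stratum T n
  have hnat : ∀ n, {x | R x = n}.Nonempty → ∃ d : ℕ, dd (PA k L) {x | R x = n} = d :=
    fun n hn => dd_nat PA_aff.1 hn
  have hZc : Z ⊆ ⋃ n ∈ Finset.range (N + 1), E n := fun p hp =>
    Set.mem_biUnion (x := R p.1) (by have := hRN p.1; simp; omega) ⟨rfl, hp⟩
  have hEZ : ∀ n, E n ⊆ Z := fun n p hp => hp.2
  obtain ⟨D, hD⟩ : ∃ D : ℕ, dd (PA k (L × L)) Z = D :=
    dd_nat PA_aff.1 ⟨0, by simp [hZ]⟩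
  have hle : ∀ n d : ℕ, dd (PA k L) {x | R x = n} = d → d + (N - n) ≤ D := by
    intro n d h
    have h1 := dd_mono (PA k (L × L)) (hEZ n)
    rw [(hst n).2, h, hD] at h1
    exact_mod_cast h1
  obtain ⟨n0, -, hmax⟩ := Finset.exists_max_image (Finset.range (N + 1))
    (fun n => dd (PA k (L × L)) (E n)) ⟨0, by simp⟩
  have hDn : dd (PA k (L × L)) (E n0) = D := by
    rw [← hD]
    exact le_antisymm (dd_mono _ (hEZ n0)) ((dd_mono _ hZc).trans (dd_biUnion_le _ _ E _ hmax))
  have hne0 : {x | R x = n0}.Nonempty := by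
    by_contra h
    rw [Set.not_nonempty_iff_eq_empty] at h
    rw [(hst n0).2, h, dd_empty, WithBot.bot_add] at hDn
    exact WithBot.bot_ne_coe hDn
  have hleN : ∀ n, {x | R x = n}.Nonempty → n ≤ N := by
    rintro n ⟨x, rfl⟩
    exact hRN x
  have hND : N ≤ D := by
    obtain ⟨d, hd⟩ := hnat 0 ⟨0, by simp [hR]⟩
    have := hle 0 d hd
    omega
  refine ⟨D - N, ?_, ⟨n0, hne0, ?_⟩, ?_⟩
  · intro n hn
    obtain ⟨d, hd⟩ := hnat n hn
    rw [(hst n).1, hd]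
    have h1 := hle n d hd
    have h2 := hleN n hn
    have : d ≤ D - N + n := by omega
    exact_mod_cast this
  · obtain ⟨d, hd⟩ := hnat n0 hne0
    rw [(hst n0).1, hd]
    rw [(hst n0).2, hd] at hDn
    have h1 : d + (N - n0) = D := by exact_mod_cast hDn
    have h2 := hleN n0 hne0
    have : d = D - N + n0 := by omega
    rw [← this]
  · rw [comm_sdim, hD]
    congr 1
    have : D = N + (D - N) := by omega
    exact_mod_cast this

end Main

/-- `dim C₂(𝔤) = dim_k 𝔤 + mod(𝔤)`, where
`mod(𝔤) = max_{n, 𝔤₍ₙ₎ ≠ ∅} (dim 𝔤₍ₙ₎ − n)`.  The maximum defining `mod(𝔤)` is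
expressed additively: `m = mod(𝔤)` iff `dim 𝔤₍ₙ₎ ≤ m + n` for all `n` with
`𝔤₍ₙ₎ ≠ ∅`, with equality for some such `n`. -/
theorem dim_commSet_eq_dim_add_mod (k L : Type*) [Field k] [IsAlgClosed k]
    [LieRing L] [LieAlgebra k L] [Module.Finite k L] :
    ∃ m : ℕ,
      (∀ n : ℕ, (grk k L n).Nonempty →
        sdim (zariski k L) (grk k L n) ≤ ((m + n : ℕ) : WithBot ℕ∞)) ∧
      (∃ n : ℕ, (grk k L n).Nonempty ∧
        sdim (zariski k L) (grk k L n) = ((m + n : ℕ) : WithBot ℕ∞)) ∧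
      sdim (zariski k (L × L)) (commSet L) = ((Module.finrank k L + m : ℕ) : WithBot ℕ∞) := by
  exact main_abs (LinearMap.mk₂ k (fun x y : L => ⁅x, y⁆) (by simp) (by simp) (by simp) (by simp))
end

section
/- Let 𝔤 be a finite-dimensional Lie algebra and n₀ = max{n : 𝔤₍ₙ₎ ≠ ∅} where 𝔤₍ₙ₎ = {x ∈ 𝔤 : rank(ad x) = n}. Then 𝔤₍ₙ₀₎ is a dense open subset of 𝔤, and the closure of pr₁⁻¹(𝔤₍ₙ₀₎) in C₂(𝔤) is an irreducible component of C₂(𝔤) of dimension 2·dim_k 𝔤 − n₀. -/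
/-- The algebra of polynomial functions on `V`. -/
abbrev PolyFun (k V : Type*) [CommRing k] [AddCommGroup V] [Module k V] : Subalgebra k (V → k) :=
  Algebra.adjoin k {g : V → k | IsLinearMap k g}

lemma zariski_basis (k V : Type*) [Field k] [AddCommGroup V] [Module k V] :
    @TopologicalSpace.IsTopologicalBasis V (zariski k V)
      {U | ∃ f ∈ PolyFun k V, U = {v | f v ≠ 0}} := by
  let _ := zariski k V
  refine TopologicalSpace.isTopologicalBasis_of_subbasis_of_finiteInter rfl ?_
  refine ⟨⟨1, one_mem _, by simp⟩, ?_⟩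
  rintro _ ⟨f, hf, rfl⟩ _ ⟨g, hg, rfl⟩
  refine ⟨f * g, mul_mem hf hg, ?_⟩
  ext v
  simp [not_or]

lemma mem_closure_z {k V : Type*} [Field k] [AddCommGroup V] [Module k V] {S : Set V} {p : V} :
    p ∈ @closure V (zariski k V) S ↔
      ∀ f ∈ PolyFun k V, (∀ s ∈ S, f s = 0) → f p = 0 := by
  let _ := zariski k V
  rw [(zariski_basis k V).mem_closure_iff]
  constructor
  · intro h f hf h0
    by_contra hp
    obtain ⟨x, hx, hxS⟩ := h _ ⟨f, hf, rfl⟩ hp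
    exact hx (h0 x hxS)
  · rintro h _ ⟨f, hf, rfl⟩ hp
    by_contra hne
    refine hp (h f hf fun s hs => ?_)
    by_contra h0
    exact hne ⟨s, h0, hs⟩

lemma irr_z {k V : Type*} [Field k] [AddCommGroup V] [Module k V] {S : Set V} :
    @IsIrreducible V (zariski k V) S ↔ S.Nonempty ∧
      ∀ f ∈ PolyFun k V, ∀ g ∈ PolyFun k V, (∀ s ∈ S, f s * g s = 0) →
        (∀ s ∈ S, f s = 0) ∨ (∀ s ∈ S, g s = 0) := by
  let _ := zariski k V
  refine and_congr Iff.rfl ?_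
  constructor
  · intro h f hf g hg h0
    by_contra hne
    push Not at hne
    obtain ⟨⟨a, ha, ha'⟩, b, hb, hb'⟩ := hne
    obtain ⟨x, hx, hx1, hx2⟩ := h _ _ ((zariski_basis k V).isOpen ⟨f, hf, rfl⟩)
      ((zariski_basis k V).isOpen ⟨g, hg, rfl⟩) ⟨a, ha, ha'⟩ ⟨b, hb, hb'⟩
    exact mul_ne_zero hx1 hx2 (h0 x hx)
  · rintro h u v hu hv ⟨a, ha, hau⟩ ⟨b, hb, hbv⟩
    obtain ⟨_, ⟨f, hf, rfl⟩, haf, hfu⟩ := (zariski_basis k V).exists_subset_of_mem_open hau hu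
    obtain ⟨_, ⟨g, hg, rfl⟩, hbg, hgv⟩ := (zariski_basis k V).exists_subset_of_mem_open hbv hv
    by_contra hne
    have h0 : ∀ s ∈ S, f s * g s = 0 := by
      intro s hs
      by_contra h3
      exact hne ⟨s, hs, hfu (left_ne_zero_of_mul h3), hgv (right_ne_zero_of_mul h3)⟩
    rcases h f hf g hg h0 with h1 | h1
    · exact haf (h1 a ha)
    · exact hbg (h1 b hb)

lemma isOpen_D {k V : Type*} [Field k] [AddCommGroup V] [Module k V] {f : V → k}
    (hf : f ∈ PolyFun k V) : @IsOpen V (zariski k V) {v | f v ≠ 0} :=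
  let _ := zariski k V
  (zariski_basis k V).isOpen ⟨f, hf, rfl⟩

lemma lin_mem_s5 {k V : Type*} [Field k] [AddCommGroup V] [Module k V] (l : V →ₗ[k] k) :
    (fun v => l v) ∈ PolyFun k V :=
  Algebra.subset_adjoin l.isLinear

lemma const_mem {k V : Type*} [Field k] [AddCommGroup V] [Module k V] (c : k) :
    (fun _ => c) ∈ PolyFun k V :=
  (PolyFun k V).algebraMap_mem c

/-- Polynomial maps. -/
def IsPolyMap (k : Type*) {V W : Type*} [Field k] [AddCommGroup V] [Module k V]
    [AddCommGroup W] [Module k W] (φ : W → V) : Prop :=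
  ∀ l : V →ₗ[k] k, (fun w => l (φ w)) ∈ PolyFun k W

section
variable {k V W : Type*} [Field k] [AddCommGroup V] [Module k V] [AddCommGroup W] [Module k W]

lemma IsPolyMap.comp {φ : W → V} (h : IsPolyMap k φ) {f : V → k} (hf : f ∈ PolyFun k V) :
    (fun w => f (φ w)) ∈ PolyFun k W := by
  induction hf using Algebra.adjoin_induction with
  | mem f hf => exact h (hf.mk' f)
  | algebraMap r => exact const_mem r
  | add f g _ _ h1 h2 => exact add_mem h1 h2
  | mul f g _ _ h1 h2 => exact mul_mem h1 h2

lemma LinearMap.isPolyMap (φ : W →ₗ[k] V) : IsPolyMap k φ := fun l => lin_mem_s5 (l ∘ₗ φ)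

lemma exists_line {f : V → k} (hf : f ∈ PolyFun k V) (p v : V) :
    ∃ P : Polynomial k, ∀ t, P.eval t = f (p + t • v) := by
  induction hf using Algebra.adjoin_induction with
  | mem f hf =>
    refine ⟨Polynomial.C (f p) + Polynomial.X * Polynomial.C (f v), fun t => ?_⟩
    simp [hf.map_add, hf.map_smul]
    exact mul_comm _ _
  | algebraMap r => exact ⟨Polynomial.C r, fun t => by simp⟩
  | add f g _ _ h1 h2 =>
    obtain ⟨P, hP⟩ := h1
    obtain ⟨Q, hQ⟩ := h2
    exact ⟨P + Q, fun t => by simp [hP, hQ]⟩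
  | mul f g _ _ h1 h2 =>
    obtain ⟨P, hP⟩ := h1
    obtain ⟨Q, hQ⟩ := h2
    exact ⟨P * Q, fun t => by simp [hP, hQ]⟩

lemma poly_domain [Infinite k] {f g : V → k} (hf : f ∈ PolyFun k V) (hg : g ∈ PolyFun k V)
    (h : ∀ v, f v * g v = 0) : (∀ v, f v = 0) ∨ (∀ v, g v = 0) := by
  by_contra hne
  push Not at hne
  obtain ⟨⟨a, ha⟩, b, hb⟩ := hne
  obtain ⟨P, hP⟩ := exists_line hf a (b - a)
  obtain ⟨Q, hQ⟩ := exists_line hg a (b - a)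
  have h0 : P * Q = 0 := Polynomial.funext fun t => by simp [hP, hQ, h]
  rcases mul_eq_zero.mp h0 with h1 | h1
  · apply ha; have := hP 0; simpa [h1] using this.symm
  · apply hb; have := hQ 1; simpa [h1] using this.symm

lemma irr_range [Infinite k] {φ : W → V} (h : IsPolyMap k φ) :
    @IsIrreducible V (zariski k V) (Set.range φ) := by
  rw [irr_z]
  refine ⟨Set.range_nonempty φ, fun f hf g hg h0 => ?_⟩
  have := poly_domain (h.comp hf) (h.comp hg) (fun v => h0 _ ⟨v, rfl⟩)
  simpa using this

lemma IsPolyMap.comp' {U : Type*} [AddCommGroup U] [Module k U] {φ : W → V} (h : IsPolyMap k φ)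
    {χ : U → W} (h' : IsPolyMap k χ) : IsPolyMap k (fun u => φ (χ u)) :=
  fun l => h'.comp (h l)

lemma IsPolyMap.add {φ ψ : W → V} (h : IsPolyMap k φ) (h' : IsPolyMap k ψ) :
    IsPolyMap k (fun w => φ w + ψ w) := fun l => by
  simp only [map_add]
  exact add_mem (h l) (h' l)

lemma IsPolyMap.smul {φ : W → V} (h : IsPolyMap k φ) {g : W → k} (hg : g ∈ PolyFun k W) :
    IsPolyMap k (fun w => g w • φ w) := fun l => by
  simp only [map_smul]
  exact mul_mem hg (h l)

lemma IsPolyMap.const (v : V) : IsPolyMap k (fun _ : W => v) := fun l => const_mem (l v)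

lemma IsPolyMap.prodMk {U : Type*} [AddCommGroup U] [Module k U] {φ : W → V} (h : IsPolyMap k φ)
    {χ : W → U} (h' : IsPolyMap k χ) : IsPolyMap k (fun w => (φ w, χ w)) := by
  have := ((LinearMap.inl k V U).isPolyMap.comp' h).add ((LinearMap.inr k V U).isPolyMap.comp' h')
  simpa using this

/-- A family of linear maps depending polynomially on a parameter. -/
lemma IsPolyMap.apply {U : Type*} [AddCommGroup U] [Module k U] [Module.Finite k U]
    {B : W → (U →ₗ[k] V)} (hB : ∀ u, IsPolyMap k (fun w => B w u))
    {χ : W → U} (h' : IsPolyMap k χ) : IsPolyMap k (fun w => B w (χ w)) := by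
  intro l
  let b := Module.finBasis k U
  have : (fun w => l (B w (χ w))) = ∑ i, (fun w => b.coord i (χ w)) * (fun w => l (B w (b i))) := by
    ext w
    conv_lhs => rw [← b.sum_repr (χ w)]
    simp only [map_sum, map_smul, Finset.sum_apply, Pi.mul_apply, smul_eq_mul,
      Module.Basis.coord_apply]
  rw [this]
  exact sum_mem fun i _ => mul_mem (h' _) (hB _ l)

lemma exists_adj [Module.Finite k V] {B : W → (V →ₗ[k] V)}
    (hB : ∀ u, IsPolyMap k (fun w => B w u)) :
    ∃ (J : W → (V →ₗ[k] V)) (g : W → k), (∀ u, IsPolyMap k (fun w => J w u)) ∧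
      g ∈ PolyFun k W ∧ (∀ w, g w = LinearMap.det (B w)) ∧
      (∀ w u, B w (J w u) = g w • u) ∧ (∀ w u, J w (B w u) = g w • u) := by
  classical
  let b := Module.finBasis k V
  let M : Matrix _ _ (PolyFun k W) := Matrix.of fun i j => ⟨fun w => b.coord i (B w (b j)), hB _ _⟩
  let ev (w : W) : PolyFun k W →+* k := (Pi.evalRingHom (fun _ => k) w).comp (PolyFun k W).val.toRingHom
  have hM (w) : (ev w).mapMatrix M = LinearMap.toMatrix b b (B w) := by
    ext i j
    simp [M, ev, LinearMap.toMatrix_apply]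
  have hd (w) : ev w M.det = LinearMap.det (B w) := by
    rw [RingHom.map_det, hM, LinearMap.det_toMatrix]
  have hadj (w) : (ev w).mapMatrix M.adjugate = (LinearMap.toMatrix b b (B w)).adjugate := by
    rw [RingHom.map_adjugate, hM]
  have hd' (w) : (LinearMap.toMatrix b b (B w)).det = ev w M.det := by
    rw [hd, LinearMap.det_toMatrix]
  have hBt (w) : B w = Matrix.toLin b b (LinearMap.toMatrix b b (B w)) := by simp
  refine ⟨fun w => Matrix.toLin b b ((ev w).mapMatrix M.adjugate), fun w => ev w M.det,
    fun u l => ?_, M.det.2, hd, fun w u => ?_, fun w u => ?_⟩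
  · have : (fun w => l (Matrix.toLin b b ((ev w).mapMatrix M.adjugate) u)) =
      ∑ i, ∑ j, (fun _ => b.repr u j * l (b i)) * (M.adjugate i j : W → k) := by
      ext w
      conv_lhs => rw [← b.sum_repr u]
      simp only [map_sum, map_smul, Matrix.toLin_self, Finset.sum_apply, Pi.mul_apply, smul_eq_mul]
      rw [Finset.sum_comm]
      simp only [Finset.mul_sum]
      refine Finset.sum_congr rfl fun i _ => Finset.sum_congr rfl fun j _ => ?_
      simp [ev]; ring
    rw [this]
    exact sum_mem fun i _ => sum_mem fun j _ => mul_mem (const_mem _) (M.adjugate i j).2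
  · conv_lhs => rw [hBt w]
    simp only [hadj]
    rw [← LinearMap.comp_apply, ← Matrix.toLin_mul, Matrix.mul_adjugate, hd']
    simp
  · conv_lhs => rw [hBt w]
    simp only [hadj]
    rw [← LinearMap.comp_apply, ← Matrix.toLin_mul, Matrix.adjugate_mul, hd']
    simp
end

lemma polyFun_surj (k W : Type*) [Field k] [AddCommGroup W] [Module k W] [Module.Finite k W] :
    ∃ f : MvPolynomial (Fin (Module.finrank k W)) k →ₐ[k] PolyFun k W, Function.Surjective f := by
  let b := Module.finBasis k W
  let c : Fin (Module.finrank k W) → PolyFun k W := fun i => ⟨fun w => b.coord i w, lin_mem_s5 _⟩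
  refine ⟨MvPolynomial.aeval c, ?_⟩
  have key : PolyFun k W ≤ ((PolyFun k W).val.comp (MvPolynomial.aeval c)).range := by
    refine Algebra.adjoin_le ?_
    intro l hl
    refine ⟨∑ i, MvPolynomial.C (l (b i)) * MvPolynomial.X i, ?_⟩
    ext w
    have : l w = ∑ i, b.repr w i * l (b i) := by
      change hl.mk' l w = _
      conv_lhs => rw [← b.sum_repr w]
      simp only [map_sum, map_smul, smul_eq_mul]
      rfl
    rw [this]
    simp [c, MvPolynomial.algebraMap_eq, mul_comm, Finset.sum_apply]
  rintro ⟨x, hx⟩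
  obtain ⟨y, hy⟩ := key hx
  exact ⟨y, Subtype.ext hy⟩

lemma krull_le {k W R : Type*} [Field k] [AddCommGroup W] [Module k W] [Module.Finite k W]
    [CommRing R] [Algebra k R] [Algebra.FiniteType k R] [Nontrivial R]
    (i : R →ₐ[k] PolyFun k W) (hi : Function.Injective i) :
    ringKrullDim R ≤ (Module.finrank k W : ℕ) := by
  obtain ⟨s, g, hg, hint⟩ := exists_integral_inj_algHom_of_fg k R
  have h1 : s ≤ Module.finrank k W := by
    obtain ⟨f, hf⟩ := polyFun_surj k W
    choose r hr using hf
    let h : MvPolynomial (Fin s) k →ₐ[k] MvPolynomial (Fin (Module.finrank k W)) k :=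
      MvPolynomial.aeval (fun j => r (i (g (MvPolynomial.X j))))
    have hh : f.comp h = i.comp g := by
      ext j
      simp [h, hr]
    have hinj : Function.Injective h := by
      have : Function.Injective (f.comp h) := by
        rw [hh]; exact hi.comp hg
      exact Function.Injective.of_comp this
    have hai : AlgebraicIndependent k (fun j => r (i (g (MvPolynomial.X j)))) := hinj
    have := hai.lift_cardinalMk_le_trdeg
    rw [MvPolynomial.trdeg_of_isDomain] at this
    simpa using this
  have h2 : ringKrullDim R ≤ ringKrullDim (MvPolynomial (Fin s) k) := by
    algebraize [g.toRingHom]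
    refine Order.krullDim_le_of_strictMono (PrimeSpectrum.comap (algebraMap (MvPolynomial (Fin s) k) R)) ?_
    intro p q hpq
    exact Ideal.IsIntegral.comap_lt_comap (R := MvPolynomial (Fin s) k) hpq
  refine h2.trans ?_
  rw [MvPolynomial.ringKrullDim_of_isNoetherianRing, ringKrullDim_eq_zero_of_field]
  simpa using h1

lemma irr_preimage_val {X : Type*} [TopologicalSpace X] {C Z : Set X} (h : IsIrreducible Z)
    (hZ : Z ⊆ C) : IsIrreducible ((↑) ⁻¹' Z : Set C) := by
  obtain ⟨⟨z, hz⟩, h⟩ := h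
  refine ⟨⟨⟨z, hZ hz⟩, hz⟩, ?_⟩
  rintro _ _ ⟨u, hu, rfl⟩ ⟨v, hv, rfl⟩ ⟨a, ha, hau⟩ ⟨b, hb, hbv⟩
  obtain ⟨x, hx, hxu, hxv⟩ := h u v hu hv ⟨a, ha, hau⟩ ⟨b, hb, hbv⟩
  exact ⟨⟨x, hZ hx⟩, hx, hxu, hxv⟩

section
variable {k V W : Type*} [Field k] [AddCommGroup V] [Module k V] [AddCommGroup W] [Module k W]

/-- The ideal of polynomial functions vanishing on a set. -/
def vanI (k : Type*) {V : Type*} [Field k] [AddCommGroup V] [Module k V] (S : Set V) :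
    Ideal (PolyFun k V) where
  carrier := {f | ∀ s ∈ S, f.1 s = 0}
  zero_mem' := fun _ _ => rfl
  add_mem' := fun {f g} hf hg s hs => by
    change f.1 s + g.1 s = 0
    rw [hf s hs, hg s hs, add_zero]
  smul_mem' := fun c f hf s hs => by
    change c.1 s * f.1 s = 0
    rw [hf s hs, mul_zero]

lemma vanI_prime {S : Set V} (h : @IsIrreducible V (zariski k V) S) : (vanI k S).IsPrime := by
  rw [irr_z] at h
  obtain ⟨⟨s, hs⟩, h⟩ := h
  refine ⟨fun h1 => ?_, fun {f g} hfg => ?_⟩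
  · have : (1 : PolyFun k V) ∈ vanI k S := by rw [h1]; trivial
    exact one_ne_zero (this s hs)
  · exact h f.1 f.2 g.1 g.2 hfg

lemma sdim_le [Module.Finite k V] [Module.Finite k W] {φ : W → V} (hφ : IsPolyMap k φ) {C : Set V}
    (hC : C ⊆ @closure V (zariski k V) (Set.range φ)) :
    sdim (zariski k V) C ≤ (Module.finrank k W : ℕ) := by
  let pb : PolyFun k V →ₐ[k] PolyFun k W :=
    { toFun := fun f => ⟨fun w => f.1 (φ w), hφ.comp f.2⟩
      map_one' := rfl
      map_mul' := fun _ _ => rfl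
      map_zero' := rfl
      map_add' := fun _ _ => rfl
      commutes' := fun _ => rfl }
  have : Algebra.FiniteType k (PolyFun k V) := by
    obtain ⟨f, hf⟩ := polyFun_surj k V
    exact Algebra.FiniteType.of_surjective f hf
  have : Algebra.FiniteType k pb.range :=
    Algebra.FiniteType.of_surjective pb.rangeRestrict pb.rangeRestrict_surjective
  have hn : Nontrivial (PolyFun k W) := inferInstance
  refine le_trans ?_ (krull_le (k := k) (W := W) (R := pb.range) pb.range.val
    (fun _ _ h => Subtype.ext h))
  let _ := zariski k V
  have hcl : ∀ Z : TopologicalSpace.IrreducibleCloseds C,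
      ((Z.map ((↑) : C → V) continuous_subtype_val : TopologicalSpace.IrreducibleCloseds V) : Set V)
        ⊆ closure (Set.range φ) := by
    intro Z
    refine closure_minimal ?_ isClosed_closure
    rintro _ ⟨z, _, rfl⟩
    exact hC z.2
  have hsurj : Function.Surjective pb.rangeRestrict := pb.rangeRestrict_surjective
  have hker : ∀ S ⊆ closure (Set.range φ), RingHom.ker pb.rangeRestrict ≤ vanI k S := by
    intro S hS f hf s hs
    refine mem_closure_z.mp (hS hs) f.1 f.2 ?_
    rintro _ ⟨w, rfl⟩
    exact congrFun (congrArg (fun x : pb.range => x.1.1) hf) w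
  have hpr : ∀ Z : TopologicalSpace.IrreducibleCloseds V, (vanI k (Z : Set V)).IsPrime :=
    fun Z => vanI_prime Z.isIrreducible
  change Order.krullDim (TopologicalSpace.IrreducibleCloseds C) ≤ _
  unfold ringKrullDim
  rw [← Order.krullDim_orderDual]
  let F (Z : TopologicalSpace.IrreducibleCloseds C) : TopologicalSpace.IrreducibleCloseds V :=
    Z.map ((↑) : C → V) continuous_subtype_val
  have hF : StrictMono F :=
    TopologicalSpace.IrreducibleCloseds.map_strictMono_of_isInducing Topology.IsInducing.subtypeVal
  have hcm : ∀ Z, Ideal.comap pb.rangeRestrict (Ideal.map pb.rangeRestrict (vanI k (F Z : Set V)))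
      = vanI k (F Z : Set V) := fun Z => by
    rw [Ideal.comap_map_of_surjective _ hsurj]
    exact sup_eq_left.mpr (hker _ (hcl Z))
  let G (Z : (TopologicalSpace.IrreducibleCloseds C)ᵒᵈ) : PrimeSpectrum pb.range :=
    ⟨Ideal.map pb.rangeRestrict (vanI k (F (OrderDual.ofDual Z) : Set V)), by
      have := hpr (F (OrderDual.ofDual Z))
      exact Ideal.map_isPrime_of_surjective hsurj (hker _ (hcl _))⟩
  refine Order.krullDim_le_of_strictMono G ?_
  intro Z Z' hlt
  have h1 : F (OrderDual.ofDual Z') < F (OrderDual.ofDual Z) := hF hlt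
  refine lt_of_le_not_ge ?_ ?_
  · refine Ideal.map_mono ?_
    intro f hf s hs
    exact hf s (h1.le hs)
  · intro hle
    have hle' : vanI k (F (OrderDual.ofDual Z') : Set V) ≤ vanI k (F (OrderDual.ofDual Z) : Set V) := by
      rw [← hcm, ← hcm (OrderDual.ofDual Z)]
      exact Ideal.comap_mono hle
    refine h1.not_ge ?_
    intro x hx
    have hx' : x ∈ closure (F (OrderDual.ofDual Z') : Set V) := by
      rw [mem_closure_z]
      intro f hf h0
      exact hle' (x := ⟨f, hf⟩) h0 x hx
    rwa [(F (OrderDual.ofDual Z')).isClosed.closure_eq] at hx'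

lemma le_sdim [Infinite k] [Module.Finite k W] {φ : W → V} (hφ : IsPolyMap k φ)
    {ψ : V → W} (hψ : IsPolyMap k ψ) {g : W → k} (hg : g ∈ PolyFun k W) (hg0 : g 0 ≠ 0)
    (h : ∀ w, ψ (φ w) = g w • w) {C : Set V}
    (hC : @closure V (zariski k V) (Set.range φ) ⊆ C) :
    (Module.finrank k W : ℕ) ≤ sdim (zariski k V) C := by
  let _ := zariski k V
  change _ ≤ Order.krullDim (TopologicalSpace.IrreducibleCloseds C)
  have e : ((Module.finrank k W : ℕ) : WithBot ℕ∞) = Order.krullDim (Submodule k W) := by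
    rw [← Module.coe_length, Module.length_eq_finrank]; rfl
  rw [e]
  have hirr (N : Submodule k W) : IsIrreducible (closure (Set.range fun n : N => φ n)) :=
    (irr_range (hφ.comp' N.subtype.isPolyMap)).closure
  have hsub (N : Submodule k W) : closure (Set.range fun n : N => φ n) ⊆ C :=
    (closure_mono (by rintro _ ⟨n, rfl⟩; exact ⟨_, rfl⟩)).trans hC
  let G (N : Submodule k W) : TopologicalSpace.IrreducibleCloseds C :=
    ⟨(↑) ⁻¹' (closure (Set.range fun n : N => φ n)), irr_preimage_val (hirr N) (hsub N),
      isClosed_closure.preimage continuous_subtype_val⟩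
  refine Order.krullDim_le_of_strictMono G ?_
  intro N M hlt
  refine lt_of_le_not_ge ?_ ?_
  · intro x hx
    exact closure_mono (by rintro _ ⟨n, rfl⟩; exact ⟨⟨n, hlt.le n.2⟩, rfl⟩) hx
  · intro hle
    obtain ⟨w, hwM, hwN⟩ := SetLike.exists_of_lt hlt
    obtain ⟨l, hlw, hlN⟩ := Submodule.exists_le_ker_of_notMem hwN
    have h0 : ∀ m ∈ M, g m * l m = 0 := by
      intro m hm
      have hm' : φ m ∈ closure (Set.range fun n : M => φ n) := subset_closure ⟨⟨m, hm⟩, rfl⟩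
      have : φ m ∈ closure (Set.range fun n : N => φ n) :=
        hle (show (⟨φ m, hsub M hm'⟩ : C) ∈ G M from hm')
      have := mem_closure_z.mp this _ (hψ l) (by
        rintro _ ⟨n, rfl⟩
        simp only [h, map_smul]
        rw [show l n = 0 from hlN n.2, smul_zero])
      simpa [h] using this
    have := poly_domain (M.subtype.isPolyMap.comp hg) (M.subtype.isPolyMap.comp (lin_mem_s5 l))
      (fun m => h0 m m.2)
    rcases this with h1 | h1
    · exact hg0 (by simpa using h1 0)
    · exact hlw (h1 ⟨w, hwM⟩)
end

lemma bracket_poly {k L W : Type*} [Field k] [LieRing L] [LieAlgebra k L] [Module.Finite k L]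
    [AddCommGroup W] [Module k W] {α β : W → L} (hα : IsPolyMap k α) (hβ : IsPolyMap k β) :
    IsPolyMap k (fun w => ⁅α w, β w⁆) :=
  IsPolyMap.apply (B := fun w => LieAlgebra.ad k L (α w))
    (fun u => (IsLinearMap.mk' (fun x : L => ⁅x, u⁆)
      ⟨fun x y => add_lie x y u, fun c x => smul_lie c x u⟩).isPolyMap.comp' hα) hβ

lemma finrank_ker_eq {k L : Type*} [Field k] [LieRing L] [LieAlgebra k L] [Module.Finite k L]
    (x : L) : Module.finrank k (LinearMap.range (LieAlgebra.ad k L x)) +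
      Module.finrank k (LinearMap.ker (LieAlgebra.ad k L x)) = Module.finrank k L :=
  LinearMap.finrank_range_add_finrank_ker _

lemma chart {k L : Type*} [Field k] [LieRing L] [LieAlgebra k L] [Module.Finite k L]
    {n₀ : ℕ} (h2 : ∀ n : ℕ, (grk k L n).Nonempty → n ≤ n₀) {x₀ : L} (hx₀ : x₀ ∈ grk k L n₀) :
    ∃ (φ : L × LinearMap.ker (LieAlgebra.ad k L x₀) → L × L)
      (ψ : L × L → L × LinearMap.ker (LieAlgebra.ad k L x₀)) (g : L → k),
      IsPolyMap k φ ∧ IsPolyMap k ψ ∧ g ∈ PolyFun k L ∧ g x₀ ≠ 0 ∧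
      (∀ w, (φ w).1 = w.1) ∧ (∀ w, g w.1 ≠ 0 → φ w ∈ commSet L) ∧
      (∀ p ∈ commSet L, g p.1 ≠ 0 → p ∈ Set.range φ) ∧
      (∀ w, ψ (φ w) = g w.1 • (w.1 - x₀, w.2)) ∧
      (∀ x, g x ≠ 0 → x ∈ grk k L n₀) := by
  let a : L → (L →ₗ[k] L) := fun x => LieAlgebra.ad k L x
  let K := LinearMap.ker (a x₀)
  obtain ⟨σ, hσ⟩ := K.subtype.exists_leftInverse_of_injective K.ker_subtype
  have hσ' (w : K) : σ w = w := LinearMap.congr_fun hσ w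
  let M := LinearMap.ker σ
  have hinj : LinearMap.ker (a x₀ ∘ₗ M.subtype) = ⊥ := by
    rw [LinearMap.ker_eq_bot']
    intro m hm
    have hmK : (m : L) ∈ K := hm
    have h3 := hσ' ⟨m, hmK⟩
    have h4 : σ m = 0 := m.2
    have h5 : (⟨m, hmK⟩ : K) = 0 := by rw [← h3]; exact h4
    exact Subtype.ext (congrArg (fun z : K => (z : L)) h5)
  obtain ⟨τ, hτ⟩ := (a x₀ ∘ₗ M.subtype).exists_leftInverse_of_injective hinj
  let θ : L →ₗ[k] L := M.subtype ∘ₗ τ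
  have hσθ (y) : σ (θ y) = 0 := (τ y).2
  have hθ (y) : θ (a x₀ y) = y - σ y := by
    have hm : y - σ y ∈ M := by
      change σ (y - σ y) = 0
      rw [map_sub, hσ', sub_self]
    have h3 : a x₀ y = a x₀ (y - σ y) := by
      rw [map_sub, show a x₀ (σ y) = 0 from (σ y).2, sub_zero]
    have h4 : τ (a x₀ (y - σ y)) = ⟨_, hm⟩ := LinearMap.congr_fun hτ ⟨_, hm⟩
    rw [h3]
    change ((τ (a x₀ (y - σ y)) : M) : L) = _
    rw [h4]
  let B : L → (L →ₗ[k] L) := fun x => θ ∘ₗ a x + K.subtype ∘ₗ σ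
  have hBa (x y) : B x y = θ ⁅x, y⁆ + σ y := rfl
  have hσB (x y) : σ (B x y) = σ y := by rw [hBa, map_add, hσθ, hσ', zero_add]
  have hB : ∀ u, IsPolyMap k (fun x => B x u) := fun u => by
    simp only [hBa]
    refine IsPolyMap.add (θ.isPolyMap.comp' (bracket_poly LinearMap.id.isPolyMap (.const u)))
      (.const _)
  obtain ⟨J, g, hJ, hg, hgd, hBJ, hJB⟩ := exists_adj hB
  have hg0 : g x₀ ≠ 0 := by
    rw [hgd]
    have : B x₀ = LinearMap.id := by
      ext y
      change θ (a x₀ y) + σ y = y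
      rw [hθ]; abel
    rw [this]; simp
  have hxn (x) : Module.finrank k (LinearMap.range (a x)) ≤ n₀ := h2 _ ⟨x, rfl⟩
  have hK : n₀ + Module.finrank k K = Module.finrank k L := by
    rw [← finrank_ker_eq x₀]
    rw [show Module.finrank k (LinearMap.range (LieAlgebra.ad k L x₀)) = n₀ from hx₀]
  have hle (x) : LinearMap.ker (a x) ≤ LinearMap.ker (θ ∘ₗ a x) := LinearMap.ker_le_ker_comp _ _
  have hker (x) (hx : g x ≠ 0) : Module.finrank k (LinearMap.ker (θ ∘ₗ a x)) ≤
      Module.finrank k K := by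
    refine LinearMap.finrank_le_finrank_of_injective
      (f := σ ∘ₗ (LinearMap.ker (θ ∘ₗ a x)).subtype) ?_
    rw [← LinearMap.ker_eq_bot, LinearMap.ker_eq_bot']
    intro m hm
    have h3 : B x m = 0 := by
      change (θ ∘ₗ a x) m + ((σ m : K) : L) = 0
      rw [show (θ ∘ₗ a x) m = 0 from m.2, show σ m = 0 from hm]; simp
    have h4 := hJB x m
    rw [h3, map_zero] at h4
    exact Subtype.ext ((smul_eq_zero.mp h4.symm).resolve_left hx)
  have hkx (x : L) := finrank_ker_eq (k := k) x
  have hmem (x) (hx : g x ≠ 0) : x ∈ grk k L n₀ := by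
    have h3 := hker x hx
    have h4 := Submodule.finrank_mono (hle x)
    have h5 := hkx x
    have h6 := hxn x
    change Module.finrank k (LinearMap.range (a x)) = n₀
    change Module.finrank k (LinearMap.range (a x)) +
      Module.finrank k (LinearMap.ker (a x)) = _ at h5
    omega
  have hkeq (x) (hx : g x ≠ 0) : LinearMap.ker (a x) = LinearMap.ker (θ ∘ₗ a x) := by
    refine Submodule.eq_of_le_of_finrank_le (hle x) ?_
    have h3 := hker x hx
    have h5 := hkx x
    have h6 := hxn x
    change Module.finrank k (LinearMap.range (a x)) +
      Module.finrank k (LinearMap.ker (a x)) = _ at h5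
    omega
  refine ⟨fun w => (w.1, J w.1 w.2), fun p => (g p.1 • (p.1 - x₀), σ (B p.1 p.2)), g,
    ?_, ?_, hg, hg0, fun _ => rfl, ?_, ?_, ?_, hmem⟩
  · have hf : IsPolyMap k (fun w : L × K => w.1) := (LinearMap.fst k L K).isPolyMap
    refine hf.prodMk ?_
    exact IsPolyMap.apply (B := fun w : L × K => J w.1) (fun u => (hJ u).comp' hf)
      (K.subtype ∘ₗ LinearMap.snd k L K).isPolyMap
  · have hf : IsPolyMap k (fun w : L × L => w.1) := (LinearMap.fst k L L).isPolyMap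
    refine IsPolyMap.prodMk ?_ (σ.isPolyMap.comp' ?_)
    · have h3 := (hf.add (IsPolyMap.const (k := k) (-x₀))).smul (hf.comp hg)
      simpa only [sub_eq_add_neg] using h3
    · exact IsPolyMap.apply (B := fun w : L × L => B w.1) (fun u => (hB u).comp' hf)
        (LinearMap.snd k L L).isPolyMap
  · rintro ⟨x, w⟩ hx
    change J x w ∈ LinearMap.ker (a x)
    rw [hkeq x hx]
    change θ ⁅x, J x w⁆ = 0
    have h3 := hBJ x w
    have h4 : σ (J x w) = g x • w := by
      rw [← hσB x, h3, map_smul, hσ']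
    rw [hBa, h4] at h3
    simpa using h3
  · rintro ⟨x, y⟩ hxy hx
    refine ⟨(x, (g x)⁻¹ • σ y), ?_⟩
    have h3 : B x y = σ y := by
      rw [hBa, show ⁅x, y⁆ = 0 from hxy, map_zero, zero_add]
    have h4 := hJB x y
    rw [h3] at h4
    simp only [Submodule.coe_smul, map_smul, h4]
    rw [smul_smul, inv_mul_cancel₀ hx, one_smul]
  · rintro ⟨x, w⟩
    simp only [hBJ, map_smul, hσ']
    rfl

/-- if `n₀ = max{n : 𝔤₍ₙ₎ ≠ ∅}`, then `𝔤₍ₙ₀₎` is a dense open subset of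
`𝔤`, and the closure of `pr₁⁻¹(𝔤₍ₙ₀₎)` in `C₂(𝔤)` is an irreducible component of
`C₂(𝔤)` of dimension `2·dim_k 𝔤 − n₀`. -/
theorem closure_pr1_preimage_top_stratum (k L : Type*) [Field k] [IsAlgClosed k]
    [LieRing L] [LieAlgebra k L] [Module.Finite k L]
    (n₀ : ℕ) (h1 : (grk k L n₀).Nonempty) (h2 : ∀ n : ℕ, (grk k L n).Nonempty → n ≤ n₀) :
    @IsOpen _ (zariski k L) (grk k L n₀) ∧ @Dense _ (zariski k L) (grk k L n₀) ∧
    IsIrrCompIn (zariski k (L × L)) (commSet L)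
      (@closure _ (zariski k (L × L)) {p | p ∈ commSet L ∧ p.1 ∈ grk k L n₀}) ∧
    sdim (zariski k (L × L))
        (@closure _ (zariski k (L × L)) {p | p ∈ commSet L ∧ p.1 ∈ grk k L n₀})
      = ((2 * Module.finrank k L - n₀ : ℕ) : WithBot ℕ∞) := by
  have hinf : Infinite k := IsAlgClosed.instInfinite
  obtain ⟨x₀, hx₀⟩ := h1
  obtain ⟨φ, ψ, g, hφ, hψ, hg, hg0, hφ1, hφc, hcφ, hψφ, hgm⟩ := chart h2 hx₀
  have hfst : ∀ (U : Type _) [AddCommGroup U] [Module k U],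
      IsPolyMap k (fun w : L × U => w.1) := fun U _ _ => (LinearMap.fst k L U).isPolyMap
  have hcl : @closure _ (zariski k (L × L)) {p | p ∈ commSet L ∧ p.1 ∈ grk k L n₀} =
      @closure _ (zariski k (L × L)) (Set.range φ) := by
    let _ := zariski k (L × L)
    apply subset_antisymm
    · refine closure_minimal ?_ isClosed_closure
      rintro ⟨x₁, y₁⟩ ⟨hc, hx₁⟩
      obtain ⟨φ', -, g', hφ', -, hg', hg0', hφ1', hφc', hcφ', -, -⟩ := chart h2 hx₁
      obtain ⟨w₁, hw₁⟩ := hcφ' _ hc hg0'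
      rw [mem_closure_z]
      intro f hf h0
      have key := poly_domain (hφ'.comp hf)
        (mul_mem ((hfst _).comp hg) ((hfst _).comp hg')) (fun w => by
          by_contra hne
          have hr := right_ne_zero_of_mul hne
          have hl := left_ne_zero_of_mul hne
          have hr1 : g w.1 ≠ 0 := left_ne_zero_of_mul hr
          have hr2 : g' w.1 ≠ 0 := right_ne_zero_of_mul hr
          exact hl (h0 _ (hcφ _ (hφc' w hr2) (by rw [hφ1']; exact hr1))))
      rcases key with h3 | h3
      · rw [← hw₁]; exact h3 w₁
      · exfalso
        rcases poly_domain hg hg' (fun x => h3 (x, 0)) with h4 | h4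
        · exact hg0 (h4 _)
        · exact hg0' (h4 _)
    · refine closure_minimal ?_ isClosed_closure
      rintro _ ⟨w₁, rfl⟩
      rw [mem_closure_z]
      intro f hf h0
      have key := poly_domain (hφ.comp hf) ((hfst _).comp hg) (fun w => by
          by_contra hne
          have hr : g w.1 ≠ 0 := right_ne_zero_of_mul hne
          exact left_ne_zero_of_mul hne
            (h0 _ ⟨hφc w hr, by rw [hφ1]; exact hgm _ hr⟩))
      rcases key with h3 | h3
      · exact h3 w₁
      · exact (hg0 (h3 (x₀, 0))).elim
  have hsubc : @closure _ (zariski k (L × L)) {p | p ∈ commSet L ∧ p.1 ∈ grk k L n₀}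
      ⊆ commSet L := by
    intro p hp
    rw [mem_closure_z] at hp
    change ⁅p.1, p.2⁆ = 0
    rw [← Module.forall_dual_apply_eq_zero_iff k]
    intro l
    refine hp _ (bracket_poly (hfst L) (LinearMap.snd k L L).isPolyMap l) ?_
    rintro q ⟨hq, -⟩
    change l ⁅q.1, q.2⁆ = 0
    rw [show ⁅q.1, q.2⁆ = 0 from hq, map_zero]
  refine ⟨?_, ?_, ⟨hsubc, ?_, ?_⟩, ?_⟩
  · let _ := zariski k L
    rw [isOpen_iff_forall_mem_open]
    intro x hx
    obtain ⟨-, -, g', -, -, hg', hg0', -, -, -, -, hgm'⟩ := chart h2 hx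
    exact ⟨_, fun y hy => hgm' y hy, isOpen_D hg', hg0'⟩
  · intro x
    rw [mem_closure_z]
    intro f hf h0
    rcases poly_domain hf hg (fun v => by
      by_contra hne
      exact left_ne_zero_of_mul hne (h0 _ (hgm v (right_ne_zero_of_mul hne)))) with h3 | h3
    · exact h3 x
    · exact (hg0 (h3 _)).elim
  · rw [hcl]
    let _ := zariski k (L × L)
    exact (irr_range hφ).closure
  · intro D hDc hD hsub
    refine subset_antisymm hsub ?_
    intro p hp
    rw [mem_closure_z]
    intro f hf h0
    rcases (irr_z.mp hD).2 f hf _ ((hfst L).comp hg) (fun s hs => by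
      by_contra hne
      exact left_ne_zero_of_mul hne (h0 _ ⟨hDc hs, hgm _ (right_ne_zero_of_mul hne)⟩)) with h3 | h3
    · exact h3 p hp
    · refine (hg0 (h3 (x₀, 0) (hsub ?_))).elim
      let _ := zariski k (L × L)
      exact subset_closure ⟨lie_zero _, hx₀⟩
  · have hdim : Module.finrank k (L × LinearMap.ker (LieAlgebra.ad k L x₀)) =
        2 * Module.finrank k L - n₀ := by
      have h3 := finrank_ker_eq (k := k) x₀
      rw [show Module.finrank k (LinearMap.range (LieAlgebra.ad k L x₀)) = n₀ from hx₀] at h3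
      rw [Module.finrank_prod]
      omega
    rw [hcl, ← hdim]
    apply le_antisymm
    · exact sdim_le hφ subset_rfl
    · have htr : IsPolyMap k (fun w : L × LinearMap.ker (LieAlgebra.ad k L x₀) => w + (x₀, 0)) :=
        LinearMap.id.isPolyMap.add (.const _)
      refine le_sdim (hφ.comp' htr) hψ (((hfst _).comp' htr).comp hg) (by simpa using hg0)
        (fun w => ?_) ?_
      · rw [hψφ]; simp
      · let _ := zariski k (L × L)
        exact closure_mono (by rintro _ ⟨w, rfl⟩; exact ⟨_, rfl⟩)
end
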